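/- For every β > 0 there exists a constant c(β) > 0 such that for every n ≥ 1, the critical FK Ising measure on R_n^β with free boundary conditions satisfies P⁰_{R_n^β}(x ↝ u) ≥ c(β)/n for all x = (x₁,0) ∈ ∂₋R_n^β and u = (u₁,2n) ∈ ∂₊R_n^β with |x₁| ≤ βn/2 and |u₁| ≤ βn/2. -/

import Mathlib

attribute [local instance] Classical.propDecidable

namespace RSW

/-! ## Basic lattice notions -/

abbrev V : Type := ℤ × ℤ

/-- Two sites of `ℤ²` are adjacent if they are at graph distance `1`. -/
def adjacent (x y : V) : Prop := (x.1 - y.1).natAbs + (x.2 - y.2).natAbs = 1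

/-- An edge of the square lattice `ℤ²`. -/
def IsLatticeEdge (e : Sym2 V) : Prop := ∃ x y : V, adjacent x y ∧ e = s(x, y)

/-- The edges of the subgraph of `ℤ²` induced by a set `S` of vertices. -/
def latticeEdges (S : Set V) : Set (Sym2 V) := {e | IsLatticeEdge e ∧ ∀ v ∈ e, v ∈ S}

/-- The number of edges of the graph on `S` incident to `v`. -/
noncomputable def degIn (S : Set V) (v : V) : ℕ := Set.ncard {e ∈ latticeEdges S | v ∈ e}

/-- The boundary of the subgraph induced by `S`: vertices with fewer than four incident edges. -/
def boundaryVerts (S : Set V) : Set V := {v ∈ S | degIn S v < 4}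

/-- The boundary edges `∂ₑD`: edges between boundary sites. -/
def boundaryEdges (S : Set V) : Set (Sym2 V) := {e ∈ latticeEdges S | ∀ v ∈ e, v ∈ boundaryVerts S}

/-- A boundary condition: a set of abstract edges joining boundary vertices. -/
def ValidBC (S : Set V) (ξ : Set (Sym2 V)) : Prop := ∀ e ∈ ξ, ∀ v ∈ e, v ∈ boundaryVerts S

/-- The wiring of a set `S` of vertices: all abstract edges between distinct members of `S`. -/
def wirePairs (S : Set V) : Set (Sym2 V) := {e | ∃ x ∈ S, ∃ y ∈ S, x ≠ y ∧ e = s(x, y)}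

/-! ## The FK (random-cluster) measure -/

/-- `k(ω,ξ)`: number of connected components of the graph on the vertex set `S` whose
edges are `E` (counted via the number of distinct reachability classes of members of `S`). -/
noncomputable def numComps (S : Set V) (E : Set (Sym2 V)) : ℕ :=
  Set.ncard {C : Set V | ∃ v ∈ S, C = {w | Relation.ReflTransGen (fun x y => s(x, y) ∈ E) v w}}

/-- The FK weight `p^{o(ω)} (1-p)^{c(ω)} q^{k(ω,ξ)}` of a configuration `ω` on the edge set
`Eset` of the graph with vertex set `S`, with boundary condition `ξ`. -/
noncomputable def FKweight (p q : ℝ) (Eset : Set (Sym2 V)) (S : Set V) (ξ : Set (Sym2 V))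
    (ω : Finset (Sym2 V)) : ℝ :=
  p ^ ω.card * (1 - p) ^ (Eset \ ↑ω).ncard * q ^ numComps S (↑ω ∪ ξ)

/-- The FK partition function. -/
noncomputable def FKZ (p q : ℝ) (Eset : Set (Sym2 V)) (S : Set V) (ξ : Set (Sym2 V)) : ℝ :=
  ∑' ω : Finset (Sym2 V),
    if (↑ω : Set (Sym2 V)) ⊆ Eset then FKweight p q Eset S ξ ω else 0

/-- The FK probability of an event `A` (a set of configurations). -/
noncomputable def FKprob (p q : ℝ) (Eset : Set (Sym2 V)) (S : Set V) (ξ : Set (Sym2 V))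
    (A : Set (Set (Sym2 V))) : ℝ :=
  (∑' ω : Finset (Sym2 V),
      if (↑ω : Set (Sym2 V)) ⊆ Eset ∧ (↑ω : Set (Sym2 V)) ∈ A
      then FKweight p q Eset S ξ ω else 0) / FKZ p q Eset S ξ

/-- The FK expectation of a complex-valued function of the configuration. -/
noncomputable def FKCexp (p q : ℝ) (Eset : Set (Sym2 V)) (S : Set V) (ξ : Set (Sym2 V))
    (f : Set (Sym2 V) → ℂ) : ℂ :=
  (∑' ω : Finset (Sym2 V),
      if (↑ω : Set (Sym2 V)) ⊆ Eset
      then (FKweight p q Eset S ξ ω : ℂ) * f (↑ω : Set (Sym2 V)) else 0) /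
    (FKZ p q Eset S ξ : ℂ)

/-- The critical / self-dual point `p_sd = √2 / (1 + √2)` of the FK Ising model (`q = 2`). -/
noncomputable def psd : ℝ := Real.sqrt 2 / (1 + Real.sqrt 2)

/-- The critical FK Ising measure (`q = 2`, `p = p_sd`) on the subgraph induced by `S`
with boundary condition `ξ`. -/
noncomputable def FKIsing (S : Set V) (ξ : Set (Sym2 V)) (A : Set (Set (Sym2 V))) : ℝ :=
  FKprob psd 2 (latticeEdges S) S ξ A

/-! ## Connection events -/

/-- `x ↝ y`: the sites `x` and `y` are joined by an open path of `ω`. -/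
def Conn (ω : Set (Sym2 V)) (x y : V) : Prop :=
  Relation.ReflTransGen (fun u w => adjacent u w ∧ s(u, w) ∈ ω) x y

/-- `X ↝ Y` for sets of vertices. -/
def ConnSets (ω : Set (Sym2 V)) (X Y : Set V) : Prop := ∃ x ∈ X, ∃ y ∈ Y, Conn ω x y

/-- `S` disconnects `X` from `Y` inside `D`: every nearest-neighbour path contained in `D`
from `X` to `Y` meets `S`. -/
def CutsInside (D S X Y : Set V) : Prop :=
  ∀ (x : V) (p : List V), (x :: p).Chain' adjacent → (∀ v ∈ x :: p, v ∈ D) → x ∈ X →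
    (x :: p).getLast (List.cons_ne_nil x p) ∈ Y → ∃ v ∈ x :: p, v ∈ S

/-- An open circuit (closed nearest-neighbour path all of whose edges are open). -/
def IsOpenCycle (ω : Set (Sym2 V)) : List V → Prop
  | [] => False
  | v :: l => List.Chain (fun a b => adjacent a b ∧ s(a, b) ∈ ω) v (l ++ [v])

/-! ## The Ising model at the critical temperature -/

/-- The critical inverse temperature `β_c = (1/2) log(1+√2)`. -/
noncomputable def betac : ℝ := (1 / 2) * Real.log (1 + Real.sqrt 2)

/-- The spin at `x` of the configuration whose set of `+1` spins is `A`. -/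
noncomputable def spin (A : Set V) (x : V) : ℝ := if x ∈ A then 1 else -1

/-- The product of the two spins at the end-points of an edge. -/
noncomputable def edgeSpinProd (A : Set V) : Sym2 V → ℝ :=
  Sym2.lift ⟨fun x y => spin A x * spin A y, fun _ _ => mul_comm _ _⟩

/-- The Boltzmann weight `exp(β_c Σ_{{x,y} edge of Λ} σ_x σ_y)` of the spin configuration
with `+1`-set `A` on the subgraph induced by `Λ`. -/
noncomputable def isingWeight (Λ : Set V) (A : Finset V) : ℝ :=
  Real.exp (betac * ∑' e : Sym2 V, if e ∈ latticeEdges Λ then edgeSpinProd (↑A) e else 0)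

/-- Compatibility with the boundary condition prescribing `+1` on `plus` and `-1` on `minus`. -/
def isingOK (Λ plus minus : Set V) (A : Finset V) : Prop :=
  (↑A : Set V) ⊆ Λ ∧ plus ∩ Λ ⊆ ↑A ∧ ∀ v ∈ minus, v ∉ A

noncomputable def isingZ (Λ plus minus : Set V) : ℝ :=
  ∑' A : Finset V, if isingOK Λ plus minus A then isingWeight Λ A else 0

/-- The critical Ising probability of a spin event `ev` (a set of `+1`-spin sets), on the
graph induced by `Λ`, with spins forced to `+1` on `plus` and to `-1` on `minus`. -/
noncomputable def isingProb (Λ plus minus : Set V) (ev : Set (Set V)) : ℝ :=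
  (∑' A : Finset V,
      if isingOK Λ plus minus A ∧ (↑A : Set V) ∈ ev then isingWeight Λ A else 0) /
    isingZ Λ plus minus

/-- The critical Ising expectation of an observable `f` of the spin configuration. -/
noncomputable def isingExp (Λ plus minus : Set V) (f : Set V → ℝ) : ℝ :=
  (∑' A : Finset V, if isingOK Λ plus minus A then isingWeight Λ A * f ↑A else 0) /
    isingZ Λ plus minus

/-! ## Dobrushin domains and the medial lattice -/

/-- A medial edge, encoded by the (black face, white face) pair of medial faces it separates:
the black face of the primal site `b` and the white face of the dual site `w + (1/2, 1/2)`. -/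
abbrev MEdge : Type := V × V

/-- Vertices carried by a set of edges. -/
def edgeSupport (E : Set (Sym2 V)) : Set V := {v | ∃ e ∈ E, v ∈ e}

def EdgeConnected (E : Set (Sym2 V)) : Prop :=
  ∀ x ∈ edgeSupport E, ∀ y ∈ edgeSupport E,
    Relation.ReflTransGen (fun u w => s(u, w) ∈ E) x y

/-- A self-avoiding polygon: a nonempty connected set of edges all of whose vertices
have degree two. -/
def IsSelfAvoidingPolygon (E : Set (Sym2 V)) : Prop :=
  E.Nonempty ∧ (∀ v ∈ edgeSupport E, Set.ncard {e ∈ E | v ∈ e} = 2) ∧ EdgeConnected E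

/-- A Dobrushin domain `(D,a,b)`: a subgraph of `ℤ²` whose boundary edges form a
self-avoiding polygon, two marked boundary points `a`, `b`, the splitting of the boundary
polygon into the free arc `(ab)` and the wired arc `(ba)`, and the two medial edges
`e_a`, `e_b` separating the two arcs. -/
structure DobrushinDomain where
  verts : Set V
  a : V
  b : V
  freeE : Set (Sym2 V)
  wiredE : Set (Sym2 V)
  ea : MEdge
  eb : MEdge
  a_mem : a ∈ verts
  b_mem : b ∈ verts
  polygon : IsSelfAvoidingPolygon (boundaryEdges verts)
  cover : freeE ∪ wiredE = boundaryEdges verts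
  disj : Disjoint freeE wiredE
  free_conn : EdgeConnected freeE
  wired_conn : EdgeConnected wiredE
  ea_black : ea.1 = a
  eb_black : eb.1 = b

/-- The sites of the wired arc. -/
def wiredVerts (d : DobrushinDomain) : Set V := edgeSupport d.wiredE ∪ {d.a, d.b}

/-- The sites of the free arc. -/
def freeVerts (d : DobrushinDomain) : Set V := edgeSupport d.freeE ∪ {d.a, d.b}

/-- The Dobrushin boundary condition: the wiring of the wired arc. -/
noncomputable def dobXi (d : DobrushinDomain) : Set (Sym2 V) := wirePairs (wiredVerts d)

/-- The critical FK Ising measure `P_{D,a,b}` with Dobrushin boundary conditions. -/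
noncomputable def dobProb (d : DobrushinDomain) (A : Set (Set (Sym2 V))) : ℝ :=
  FKprob psd 2 (latticeEdges d.verts) d.verts (dobXi d) A

/-- The four primal sites surrounding the white face `w` (dual site `w + (1/2,1/2)`). -/
def cornersSet (w : V) : Set V := {w, w + (1, 0), w + (0, 1), w + (1, 1)}

/-- Interior white faces of the medial graph `D♦`. -/
def whiteInt (d : DobrushinDomain) : Set V := {w | ∀ c ∈ cornersSet w, c ∈ d.verts}

/-- The two white faces bordering the dual edge of a primal edge `e`. -/
def dualWhites (e : Sym2 V) : Set V := {w | ∀ v ∈ e, v ∈ cornersSet w}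

/-- The white faces of the free arc of `D♦`: white diamonds touching the free arc. -/
def whiteFree (d : DobrushinDomain) : Set V :=
  {w | w ∉ whiteInt d ∧ ∃ e ∈ d.freeE, w ∈ dualWhites e}

/-- All white faces of `D♦`. -/
def whiteFaces (d : DobrushinDomain) : Set V := whiteInt d ∪ whiteFree d

/-- The extra layer of black diamonds adjacent to the white diamonds of the free arc. -/
def extraBlack (d : DobrushinDomain) : Set V :=
  {p | p ∉ d.verts ∧ ∃ w ∈ whiteFree d, p ∈ cornersSet w}

/-- The extra layer of white diamonds adjacent to the black diamonds of the wired arc. -/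
def extraWhite (d : DobrushinDomain) : Set V :=
  {w | w ∉ whiteFaces d ∧ ∃ v ∈ wiredVerts d, v ∈ cornersSet w}

/-! ## Random walks on faces and harmonic measures -/

/-- The special jump rate `ρ = (√2 + 1)/2` onto the extra layers. -/
noncomputable def rho : ℝ := (Real.sqrt 2 + 1) / 2

/-- Jump probability of the jump chain of a continuous-time random walk with rates `rate`. -/
noncomputable def jumpP (rate : V → V → ℝ) (x y : V) : ℝ := rate x y / ∑' z : V, rate x z

/-- Weight of an `n`-step trajectory which hits `target` at its final point, not having
visited `target ∪ avoid` before. -/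
noncomputable def pathWeight (rate : V → V → ℝ) (target avoid : Set V) (x0 : V)
    (n : ℕ) (p : Fin n → V) : ℝ :=
  let q : Fin (n + 1) → V := Fin.cons x0 p
  if q (Fin.last n) ∈ target ∧ ∀ i : Fin n, q i.castSucc ∉ target ∧ q i.castSucc ∉ avoid
  then ∏ i : Fin n, jumpP rate (q i.castSucc) (q i.succ) else 0

/-- The probability that the continuous-time random walk with rates `rate` started at `x0`
hits `target` before hitting `avoid`. -/
noncomputable def hitProb (rate : V → V → ℝ) (target avoid : Set V) (x0 : V) : ℝ :=
  ∑' n : ℕ, ∑' p : Fin n → V, pathWeight rate target avoid x0 n p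

/-- The rates of the random walk on black faces of the extended medial domain `D̄♦`:
rate `1` onto ordinary adjacent black faces, rate `ρ` onto the extra layer along the free arc. -/
noncomputable def rateB (d : DobrushinDomain) (x y : V) : ℝ :=
  if adjacent x y ∧ x ∈ d.verts ∪ extraBlack d ∧ y ∈ d.verts ∪ extraBlack d then
    (if y ∈ extraBlack d then rho else 1) else 0

/-- The rates of the random walk on white faces of `D̄♦`: rate `1` onto ordinary adjacent
white faces, rate `ρ` onto the extra layer along the wired arc. -/
noncomputable def rateW (d : DobrushinDomain) (x y : V) : ℝ :=
  if adjacent x y ∧ x ∈ whiteFaces d ∪ extraWhite d ∧ y ∈ whiteFaces d ∪ extraWhite d then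
    (if y ∈ extraWhite d then rho else 1) else 0

/-- `HM_•(B)`: probability that the black walk started at `B` hits the wired arc before
hitting the extra layer along the free arc. -/
noncomputable def HMb (d : DobrushinDomain) (B : V) : ℝ :=
  hitProb (rateB d) (wiredVerts d) (extraBlack d) B

/-- `HM_∘(W)`: probability that the white walk started at `W` hits the extra layer along
the wired arc before hitting the free arc. -/
noncomputable def HMw (d : DobrushinDomain) (W : V) : ℝ :=
  hitProb (rateW d) (extraWhite d) (whiteFree d) W

/-! ## The exploration path and Smirnov's fermionic observable

Medial vertices are encoded in doubled coordinates: the medial vertex at the midpoint of a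
primal edge has exactly one odd coordinate.  Every medial edge carries its canonical
orientation (the black face lies on its left). -/

/-- Rotation by `+π/2`. -/
def rotL (dv : V) : V := (-dv.2, dv.1)

def halfp (p : V) : V := (p.1 / 2, p.2 / 2)

/-- Starting medial vertex (in doubled coordinates) of a medial edge in its canonical
orientation (black face on the left). -/
def mStart (e : MEdge) : V :=
  let o : V := e.2 - e.1
  if o = ((0 : ℤ), (0 : ℤ)) then (2 * e.1.1 + 1, 2 * e.1.2)
  else if o = ((-1 : ℤ), (0 : ℤ)) then (2 * e.1.1, 2 * e.1.2 + 1)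
  else if o = ((-1 : ℤ), (-1 : ℤ)) then (2 * e.1.1 - 1, 2 * e.1.2)
  else (2 * e.1.1, 2 * e.1.2 - 1)

/-- Direction of a medial edge in its canonical orientation. -/
def mDir (e : MEdge) : V :=
  let o : V := e.2 - e.1
  if o = ((0 : ℤ), (0 : ℤ)) then (-1, 1)
  else if o = ((-1 : ℤ), (0 : ℤ)) then (-1, -1)
  else if o = ((-1 : ℤ), (-1 : ℤ)) then (1, -1)
  else (1, 1)

def mEnd (e : MEdge) : V := mStart e + mDir e

/-- The primal edge whose midpoint is the medial vertex `v` (doubled coordinates). -/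
noncomputable def primalEdgeAt (v : V) : Sym2 V :=
  if v.1 % 2 ≠ 0 then s(((v.1 - 1) / 2, v.2 / 2), ((v.1 + 1) / 2, v.2 / 2))
  else s((v.1 / 2, (v.2 - 1) / 2), (v.1 / 2, (v.2 + 1) / 2))

/-- Outgoing direction of the interface at a medial vertex: the curve bounces off open
primal edges and crosses closed ones. -/
noncomputable def nextDir (op horiz : Prop) (dv : V) : V :=
  if horiz then (if (if op then -dv.2 else dv.2) = dv.1 then rotL dv else (dv.2, -dv.1))
  else (if (if op then -dv.1 else dv.1) = dv.2 then (dv.2, -dv.1) else rotL dv)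

/-- The medial edge leaving the medial vertex `v` in direction `dv`, encoded as its
(black face, white face) pair. -/
noncomputable def edgeFromDir (v dv : V) : MEdge :=
  let cA := v + halfp (dv + rotL dv)
  let cB := v + halfp (dv - rotL dv)
  if cA.1 % 2 = 0 ∧ cA.2 % 2 = 0 then (halfp cA, halfp (cB - (1, 1)))
  else (halfp cB, halfp (cA - (1, 1)))

/-- One step of the interface for the set `O` of effectively open primal edges. -/
noncomputable def nextEdge (O : Set (Sym2 V)) (e : MEdge) : MEdge :=
  let v := mEnd e
  edgeFromDir v (nextDir (primalEdgeAt v ∈ O) (v.1 % 2 ≠ 0) (mDir e))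

/-- The medial edge visited by the interface started at `ea` after `m` steps. -/
noncomputable def gpt (O : Set (Sym2 V)) (ea : MEdge) (m : ℕ) : MEdge := (nextEdge O)^[m] ea

/-- `e ∈ γ`: the exploration path from `ea` visits `e` (no later than its arrival at `eb`). -/
noncomputable def onGamma (O : Set (Sym2 V)) (ea eb e : MEdge) : Prop :=
  ∃ n : ℕ, gpt O ea n = e ∧ ∀ m < n, gpt O ea m ≠ eb

/-- The sign (`+1` for a left turn, `-1` for a right turn) of the turn of the interface
as it leaves the medial edge `e`. -/
noncomputable def turnSign (O : Set (Sym2 V)) (e : MEdge) : ℝ :=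
  if mDir (nextEdge O e) = rotL (mDir e) then 1 else -1

/-- The winding `W_γ(ea, e)` (in radians) of the exploration path from `ea` to `e`. -/
noncomputable def windTo (O : Set (Sym2 V)) (ea eb e : MEdge) : ℝ :=
  if h : ∃ n : ℕ, gpt O ea n = e ∧ ∀ m < n, gpt O ea m ≠ eb then
    (Real.pi / 2) * ∑ i ∈ Finset.range (Nat.find h), turnSign O (gpt O ea i)
  else 0

/-- The effectively open edges for the exploration path: the open edges of `ω` together
with the edges of the wired arc. -/
def effOpen (d : DobrushinDomain) (ω : Set (Sym2 V)) : Set (Sym2 V) := ω ∪ d.wiredE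

/-- The summand `exp(-(i/2)·W_γ(e_a,e)) 𝟙_{e ∈ γ}` of Smirnov's fermionic observable. -/
noncomputable def obsval (d : DobrushinDomain) (e : MEdge) (ω : Set (Sym2 V)) : ℂ :=
  if onGamma (effOpen d ω) d.ea d.eb e then
    Complex.exp (-(Complex.I / 2) * (windTo (effOpen d ω) d.ea d.eb e : ℂ)) else 0

/-- Smirnov's fermionic observable `F(e) = E_{D,a,b}[exp(-(i/2)·W_γ(e_a,e)) 𝟙_{e ∈ γ}]`. -/
noncomputable def Fobs (d : DobrushinDomain) (e : MEdge) : ℂ :=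
  FKCexp psd 2 (latticeEdges d.verts) d.verts (dobXi d) (obsval d e)

/-- A medial edge of the medial graph `D♦`. -/
def InMedial (d : DobrushinDomain) (e : MEdge) : Prop :=
  e.1 ∈ d.verts ∧ e.2 ∈ whiteFaces d

/-- A Dobrushin `ℍ`-domain: contained in the upper half-plane, with the origin on its
free arc. -/
def IsHDomain (d : DobrushinDomain) : Prop :=
  (∀ v ∈ d.verts, 0 ≤ v.2) ∧ ((0, 0) : V) ∈ edgeSupport d.freeE

/-- The vertical segment `l_n(k) = {k} × ⟦0,n⟧`. -/
def lseg (n k : ℤ) : Set V := {v | v.1 = k ∧ 0 ≤ v.2 ∧ v.2 ≤ n}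

/-- The graph distance `d₁(0)` from the origin to the wired arc. -/
noncomputable def distToWired (d : DobrushinDomain) : ℕ :=
  sInf {n : ℕ | ∃ v ∈ wiredVerts d, v.1.natAbs + v.2.natAbs = n}

/-! ## Geometric domains used in the statements -/

/-- The rectangle `⟦-βn, βn⟧ × ⟦0, 2n⟧`. -/
def Rnb (β : ℝ) (n : ℕ) : Set V :=
  {v | -(β * n) ≤ (v.1 : ℝ) ∧ (v.1 : ℝ) ≤ β * n ∧ 0 ≤ v.2 ∧ v.2 ≤ 2 * (n : ℤ)}

/-- The top side `∂₊R_n^β`. -/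
def topArc (β : ℝ) (n : ℕ) : Set V := {v ∈ Rnb β n | v.2 = 2 * (n : ℤ)}

/-- The bottom side `∂₋R_n^β`. -/
def botArc (β : ℝ) (n : ℕ) : Set V := {v ∈ Rnb β n | v.2 = 0}

/-- The box of diameter `k` (for the graph distance) centred at `x`. -/
def Bbox (x : V) (k : ℕ) : Set V :=
  {v | 2 * ((v.1 - x.1).natAbs + (v.2 - x.2).natAbs) ≤ k}

/-- The box `S_n = ⟦-n,n⟧²`. -/
def boxS (n : ℕ) : Set V := {v | v.1.natAbs ≤ n ∧ v.2.natAbs ≤ n}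

/-- The annulus `S_{m,n} = S_n ∖ S̊_m`. -/
def annulus (m n : ℕ) : Set V := {v ∈ boxS n | m ≤ v.1.natAbs ∨ m ≤ v.2.natAbs}

/-- The Euclidean distance between two sites of `ℤ²`. -/
noncomputable def eudV (x y : V) : ℝ :=
  Real.sqrt (((x.1 - y.1 : ℤ) : ℝ) ^ 2 + ((x.2 - y.2 : ℤ) : ℝ) ^ 2)

/-- The Euclidean position (in the plane) of a medial edge. -/
noncomputable def edgePos (e : MEdge) : ℝ × ℝ :=
  (((mStart e).1 : ℝ) / 2, ((mStart e).2 : ℝ) / 2)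

/-- The Euclidean distance in the plane. -/
noncomputable def eudP (p q : ℝ × ℝ) : ℝ :=
  Real.sqrt ((p.1 - q.1) ^ 2 + (p.2 - q.2) ^ 2)

/-! ## The Edwards–Sokal representation -/

/-- The open cluster of `v`. -/
def cluster (ω : Set (Sym2 V)) (v : V) : Set V :=
  {w | Relation.ReflTransGen (fun x y => s(x, y) ∈ ω) v w}

lemma mem_cluster_symm {ω : Set (Sym2 V)} {v w : V} (h : w ∈ cluster ω v) : v ∈ cluster ω w := by
  have : Std.Symm (fun x y : V => s(x, y) ∈ ω) := ⟨fun x y hxy => by rwa [Sym2.eq_swap]⟩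
  exact Relation.ReflTransGen.stdSymm.symm _ _ h

lemma cluster_eq_of_mem {ω : Set (Sym2 V)} {v w : V} (h : w ∈ cluster ω v) :
    cluster ω v = cluster ω w := by
  ext z
  exact ⟨fun hz => (mem_cluster_symm h).trans hz, fun hz => Relation.ReflTransGen.trans h hz⟩

lemma self_mem_cluster (ω : Set (Sym2 V)) (v : V) : v ∈ cluster ω v := Relation.ReflTransGen.refl

/-- The spin configuration `A` is constant along the edges of `ω`. -/
def Compat (ω : Set (Sym2 V)) (A : Finset V) : Prop := ∀ e ∈ ω, edgeSpinProd (↑A) e = 1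

lemma spin_eq_one_or (A : Set V) (x : V) : spin A x = 1 ∨ spin A x = -1 := by
  unfold spin; split_ifs <;> simp

lemma edgeSpinProd_mk (A : Set V) (x y : V) : edgeSpinProd A s(x, y) = spin A x * spin A y := rfl

lemma edgeSpinProd_eq_one_iff (A : Finset V) (x y : V) :
    edgeSpinProd (↑A) s(x, y) = 1 ↔ (x ∈ A ↔ y ∈ A) := by
  rw [edgeSpinProd_mk]
  unfold spin
  by_cases hx : x ∈ A <;> by_cases hy : y ∈ A <;> simp [hx, hy] <;> norm_num

lemma edgeSpinProd_eq_one_or (A : Set V) (e : Sym2 V) :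
    edgeSpinProd A e = 1 ∨ edgeSpinProd A e = -1 := by
  induction e using Sym2.ind with
  | _ x y =>
    rw [edgeSpinProd_mk]
    rcases spin_eq_one_or A x with h | h <;> rcases spin_eq_one_or A y with h' | h' <;>
      rw [h, h'] <;> norm_num

lemma Compat.mem_iff {ω : Set (Sym2 V)} {A : Finset V} (h : Compat ω A) {v w : V}
    (hw : w ∈ cluster ω v) : v ∈ A ↔ w ∈ A := by
  induction hw with
  | refl => rfl
  | tail _ hbc ih => exact ih.trans ((edgeSpinProd_eq_one_iff A _ _).1 (h _ hbc))

lemma card_compat (S : Finset V) (ω : Set (Sym2 V)) (hω : ∀ e ∈ ω, ∀ v ∈ e, v ∈ S) :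
    (S.powerset.filter (Compat ω)).card = 2 ^ numComps (↑S) ω := by
  have hn : numComps (↑S) ω = (S.image (cluster ω)).card := by
    unfold numComps
    rw [← Set.ncard_coe_finset]
    congr 1
    ext C
    simp only [Set.mem_ofPred_eq, Finset.coe_image, Set.mem_image]
    exact ⟨fun ⟨v, hv, h⟩ => ⟨v, hv, h.symm⟩, fun ⟨v, hv, h⟩ => ⟨v, hv, h.symm⟩⟩
  rw [hn, ← Finset.card_powerset]
  refine Finset.card_nbij' (fun A => A.image (cluster ω))
    (fun D => S.filter (fun v => cluster ω v ∈ D)) ?_ ?_ ?_ ?_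
  · intro A hA
    simp only [Finset.coe_filter, Finset.mem_powerset, Set.mem_ofPred_eq] at hA
    simp only [Finset.coe_powerset, Set.mem_preimage, Set.mem_powerset_iff, Finset.coe_subset]
    exact Finset.image_subset_image hA.1
  · intro D hD
    simp only [Finset.coe_filter, Finset.mem_powerset, Set.mem_ofPred_eq]
    refine ⟨Finset.filter_subset _ _, ?_⟩
    intro e he
    induction e using Sym2.ind with
    | _ x y =>
      rw [edgeSpinProd_eq_one_iff]
      have hx : x ∈ S := hω _ he x (by simp)
      have hy : y ∈ S := hω _ he y (by simp)
      have : cluster ω x = cluster ω y :=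
        cluster_eq_of_mem (Relation.ReflTransGen.single he)
      simp [hx, hy, this]
  · intro A hA
    simp only [Finset.coe_filter, Finset.mem_powerset, Set.mem_ofPred_eq] at hA
    ext v
    simp only [Finset.mem_filter, Finset.mem_image]
    constructor
    · rintro ⟨_, a, ha, hav⟩
      have : v ∈ cluster ω a := by rw [hav]; exact self_mem_cluster _ _
      exact (hA.2.mem_iff this).1 ha
    · intro hv
      exact ⟨hA.1 hv, v, hv, rfl⟩
  · intro D hD
    simp only [Finset.coe_powerset, Set.mem_preimage, Set.mem_powerset_iff,
      Finset.coe_subset] at hD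
    ext C
    simp only [Finset.mem_image, Finset.mem_filter]
    constructor
    · rintro ⟨v, ⟨_, hv⟩, rfl⟩
      exact hv
    · intro hC
      obtain ⟨v, hv, rfl⟩ := Finset.mem_image.1 (hD hC)
      exact ⟨v, ⟨hv, hC⟩, rfl⟩

lemma spin_symmDiff (A B : Finset V) (v : V) :
    spin (↑(symmDiff A B)) v = if v ∈ B then -spin (↑A) v else spin (↑A) v := by
  unfold spin
  simp only [Finset.mem_coe, Finset.mem_symmDiff]
  by_cases hA : v ∈ A <;> by_cases hB : v ∈ B <;> simp [hA, hB]

lemma sum_powerset_symmDiff (S B : Finset V) (hB : B ⊆ S) (F : Finset V → ℝ) :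
    ∑ A ∈ S.powerset, F (symmDiff A B) = ∑ A ∈ S.powerset, F A := by
  have key : ∀ A ∈ S.powerset, symmDiff A B ∈ S.powerset := by
    intro A hA
    rw [Finset.mem_powerset] at hA ⊢
    intro v hv
    rcases Finset.mem_symmDiff.1 hv with h | h
    · exact hA h.1
    · exact hB h.1
  exact Finset.sum_nbij' (fun A => symmDiff A B) (fun A => symmDiff A B) key key
    (fun A _ => symmDiff_symmDiff_cancel_right B A)
    (fun A _ => symmDiff_symmDiff_cancel_right B A) (fun _ _ => rfl)

lemma Compat.symmDiff {ω : Set (Sym2 V)} {A B : Finset V} (hA : Compat ω A) (hB : Compat ω B) :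
    Compat ω (symmDiff A B) := by
  intro e he
  have h1 := hA e he
  have h2 := hB e he
  induction e using Sym2.ind with
  | _ x y =>
    rw [edgeSpinProd_eq_one_iff] at *
    simp only [Finset.mem_symmDiff]
    tauto

lemma sum_compat_spin (S : Finset V) (ω : Set (Sym2 V)) (hω : ∀ e ∈ ω, ∀ v ∈ e, v ∈ S)
    {x u : V} (hx : x ∈ S) :
    ∑ A ∈ S.powerset, (if Compat ω A then spin (↑A) x * spin (↑A) u else 0) =
      if u ∈ cluster ω x then (2 : ℝ) ^ numComps (↑S) ω else 0 := by
  split_ifs with h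
  · have : ∀ A ∈ S.powerset, (if Compat ω A then spin (↑A) x * spin (↑A) u else 0) =
        if Compat ω A then (1 : ℝ) else 0 := by
      intro A _
      split_ifs with hc
      · rw [← edgeSpinProd_mk, edgeSpinProd_eq_one_iff]
        exact hc.mem_iff h
      · rfl
    rw [Finset.sum_congr rfl this, Finset.sum_boole, card_compat S ω hω]
    push_cast
    rfl
  · set B := S.filter (fun v => v ∈ cluster ω x) with hBdef
    have hB : Compat ω B := by
      intro e he
      induction e using Sym2.ind with
      | _ y z =>
        rw [edgeSpinProd_eq_one_iff]
        have hy : y ∈ S := hω _ he y (by simp)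
        have hz : z ∈ S := hω _ he z (by simp)
        have : cluster ω y = cluster ω z :=
          cluster_eq_of_mem (Relation.ReflTransGen.single he)
        simp only [hBdef, Finset.mem_filter, hy, hz, true_and]
        constructor
        · intro h; exact h.tail he
        · intro h; exact h.tail (by rwa [Sym2.eq_swap])
    have hxB : x ∈ B := by simp [hBdef, hx, self_mem_cluster]
    have huB : u ∉ B := by simp [hBdef, h]
    have h1 := sum_powerset_symmDiff S B (Finset.filter_subset _ _)
      (fun A => if Compat ω A then spin (↑A) x * spin (↑A) u else 0)
    have h2 : ∀ A ∈ S.powerset, (if Compat ω (symmDiff A B) then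
        spin (↑(symmDiff A B)) x * spin (↑(symmDiff A B)) u else 0) =
        -(if Compat ω A then spin (↑A) x * spin (↑A) u else 0) := by
      intro A _
      have hiff : Compat ω (symmDiff A B) ↔ Compat ω A := by
        refine ⟨fun h => ?_, fun h => h.symmDiff hB⟩
        have := h.symmDiff hB
        rwa [symmDiff_symmDiff_cancel_right] at this
      simp only [hiff, spin_symmDiff, hxB, huB, if_true, if_false]
      split_ifs <;> ring
    rw [Finset.sum_congr rfl h2, Finset.sum_neg_distrib] at h1
    linarith

/-- The Boltzmann weight, in the normalization of the high temperature expansion. -/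
noncomputable def bw (E : Finset (Sym2 V)) (A : Finset V) : ℝ :=
  ∏ e ∈ E, (1 + (√2 - 1) * edgeSpinProd (↑A) e)

lemma one_sub_psd : 1 - psd = √2 - 1 := by
  have h2 : √2 * √2 = 2 := Real.mul_self_sqrt (by norm_num)
  have : (0 : ℝ) < 1 + √2 := by positivity
  unfold psd
  field_simp
  linarith

lemma edge_factor (s : ℝ) (hs : s = 1 ∨ s = -1) :
    (if s = 1 then psd else 0) + (1 - psd) = (√2)⁻¹ * (1 + (√2 - 1) * s) := by
  have h2 : √2 * √2 = 2 := Real.mul_self_sqrt (by norm_num)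
  have h0 : (0 : ℝ) < √2 := by positivity
  rcases hs with rfl | rfl
  · field_simp
    norm_num
  · rw [if_neg (by norm_num), one_sub_psd]
    field_simp
    linarith

lemma sum_edges_eq (E : Finset (Sym2 V)) (A : Finset V) :
    ∑ ω ∈ E.powerset, (psd ^ ω.card * (1 - psd) ^ (E \ ω).card *
      if Compat (↑ω) A then 1 else 0) = (√2)⁻¹ ^ E.card * bw E A := by
  have h : (√2)⁻¹ ^ E.card * bw E A =
      ∏ e ∈ E, ((if edgeSpinProd (↑A) e = 1 then psd else 0) + (1 - psd)) := by
    rw [bw, ← Finset.prod_const, ← Finset.prod_mul_distrib]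
    exact Finset.prod_congr rfl fun e _ => (edge_factor _ (edgeSpinProd_eq_one_or _ e)).symm
  rw [h, Finset.prod_add]
  refine Finset.sum_congr rfl fun ω _ => ?_
  rw [Finset.prod_ite_zero, Finset.prod_const, Finset.prod_const]
  by_cases hc : Compat (↑ω) A
  · have hc' : ∀ i ∈ ω, edgeSpinProd (↑A) i = 1 := fun i hi => hc i hi
    rw [if_pos hc, if_pos hc', mul_one]
  · have hc' : ¬ ∀ i ∈ ω, edgeSpinProd (↑A) i = 1 := fun h => hc fun i hi => h i hi
    rw [if_neg hc, if_neg hc', mul_zero, zero_mul]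

lemma sum_edges_mul (S : Finset V) (E : Finset (Sym2 V)) (f : Finset V → ℝ) :
    ∑ ω ∈ E.powerset, (psd ^ ω.card * (1 - psd) ^ (E \ ω).card *
      ∑ A ∈ S.powerset, if Compat (↑ω) A then f A else 0) =
      (√2)⁻¹ ^ E.card * ∑ A ∈ S.powerset, bw E A * f A := by
  simp_rw [Finset.mul_sum]
  rw [Finset.sum_comm]
  refine Finset.sum_congr rfl fun A _ => ?_
  rw [← mul_assoc, ← sum_edges_eq, Finset.sum_mul]
  refine Finset.sum_congr rfl fun ω _ => ?_
  split_ifs <;> ring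

lemma conn_iff_mem_cluster {ω : Set (Sym2 V)} (hω : ∀ e ∈ ω, IsLatticeEdge e) (x u : V) :
    Conn ω x u ↔ u ∈ cluster ω x := by
  unfold Conn cluster
  have : (fun u w : V => adjacent u w ∧ s(u, w) ∈ ω) = fun u w => s(u, w) ∈ ω := by
    ext a b
    refine ⟨fun h => h.2, fun h => ⟨?_, h⟩⟩
    obtain ⟨y, z, hyz, he⟩ := hω _ h
    rcases Sym2.eq_iff.1 he with ⟨rfl, rfl⟩ | ⟨rfl, rfl⟩
    · exact hyz
    · unfold adjacent at *
      omega
  rw [this]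
  rfl

lemma tsum_config (S : Finset V) (E : Finset (Sym2 V)) (hE : latticeEdges ↑S = ↑E)
    (ev : Set (Set (Sym2 V))) :
    (∑' ω : Finset (Sym2 V),
      if (↑ω : Set (Sym2 V)) ⊆ latticeEdges ↑S ∧ (↑ω : Set (Sym2 V)) ∈ ev
      then FKweight psd 2 (latticeEdges ↑S) ↑S ∅ ω else 0) =
    ∑ ω ∈ E.powerset, (psd ^ ω.card * (1 - psd) ^ (E \ ω).card *
      if (↑ω : Set (Sym2 V)) ∈ ev then (2 : ℝ) ^ numComps (↑S) ↑ω else 0) := by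
  rw [tsum_eq_sum (s := E.powerset)]
  · refine Finset.sum_congr rfl fun ω hω => ?_
    rw [Finset.mem_powerset] at hω
    rw [hE]
    have h1 : (↑ω : Set (Sym2 V)) ⊆ ↑E := by exact_mod_cast hω
    have h2 : ((↑E : Set (Sym2 V)) \ ↑ω).ncard = (E \ ω).card := by
      rw [← Finset.coe_sdiff, Set.ncard_coe_finset]
    by_cases h : (↑ω : Set (Sym2 V)) ∈ ev
    · rw [if_pos ⟨h1, h⟩, if_pos h, FKweight, h2, Set.union_empty]
    · rw [if_neg (fun h' => h h'.2), if_neg h, mul_zero]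
  · intro ω hω
    rw [Finset.mem_powerset] at hω
    rw [hE, if_neg]
    rintro ⟨h, _⟩
    exact hω (by exact_mod_cast h)

theorem FKIsing_conn_eq (S : Finset V) (E : Finset (Sym2 V)) (hE : latticeEdges ↑S = ↑E)
    {x u : V} (hx : x ∈ S) :
    FKIsing ↑S ∅ {ω | Conn ω x u} =
      (∑ A ∈ S.powerset, bw E A * (spin (↑A) x * spin (↑A) u)) /
        ∑ A ∈ S.powerset, bw E A := by
  have hsub : ∀ ω ∈ E.powerset, ∀ e ∈ (↑ω : Set (Sym2 V)), e ∈ latticeEdges ↑S := by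
    intro ω hω e he
    rw [hE]
    exact_mod_cast Finset.mem_powerset.1 hω he
  have hnum := tsum_config S E hE {ω | Conn ω x u}
  have hden : FKZ psd 2 (latticeEdges ↑S) ↑S ∅ =
      (√2)⁻¹ ^ E.card * ∑ A ∈ S.powerset, bw E A := by
    have := tsum_config S E hE Set.univ
    simp only [Set.mem_univ, and_true, if_true] at this
    rw [FKZ, this]
    have h2 := sum_edges_mul S E (fun _ => 1)
    simp only [mul_one] at h2
    rw [← h2]
    refine Finset.sum_congr rfl fun ω hω => ?_
    rw [Finset.sum_boole, card_compat S ω fun e he => (hsub ω hω e he).2]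
    push_cast
    rfl
  have hnum' : ∑ ω ∈ E.powerset, (psd ^ ω.card * (1 - psd) ^ (E \ ω).card *
      if (↑ω : Set (Sym2 V)) ∈ {ω | Conn ω x u} then (2 : ℝ) ^ numComps (↑S) ↑ω else 0) =
      (√2)⁻¹ ^ E.card * ∑ A ∈ S.powerset, bw E A * (spin (↑A) x * spin (↑A) u) := by
    rw [← sum_edges_mul]
    refine Finset.sum_congr rfl fun ω hω => ?_
    rw [sum_compat_spin S ω (fun e he => (hsub ω hω e he).2) hx]
    simp only [Set.mem_ofPred_eq, conn_iff_mem_cluster fun e he => (hsub ω hω e he).1]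
  rw [FKIsing, FKprob, hnum, hnum', hden, mul_div_mul_left]
  positivity

/-! ## Griffiths' inequality -/

lemma spin_list_prod_sum_nonneg (S : Finset V) (l : List V) (hl : ∀ v ∈ l, v ∈ S) :
    0 ≤ ∑ A ∈ S.powerset, (l.map (spin (↑A))).prod := by
  have h : ∀ A ∈ S.powerset, (l.map (spin (↑A))).prod =
      (∏ v ∈ A, (1 : ℝ)) * ∏ v ∈ S \ A, (-1 : ℝ) ^ l.count v := by
    intro A hA
    rw [Finset.mem_powerset] at hA
    rw [Finset.prod_list_map_count]
    have hsub : l.toFinset ⊆ S := fun v hv => hl v (List.mem_toFinset.1 hv)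
    rw [Finset.prod_subset hsub, ← Finset.prod_sdiff hA, mul_comm]
    · congr 1
      · refine Finset.prod_congr rfl fun v hv => ?_
        simp [spin, hv]
      · refine Finset.prod_congr rfl fun v hv => ?_
        simp only [spin, Finset.mem_coe, (Finset.mem_sdiff.1 hv).2, if_false]
        congr!
    · intro v _ hv
      convert pow_zero _
      exact @List.count_eq_zero_of_not_mem V instBEqOfDecidableEq _ v l
        fun h => hv (List.mem_toFinset.2 h)
  rw [Finset.sum_congr rfl h, ← Finset.prod_add]
  refine Finset.prod_nonneg fun v _ => ?_
  rcases neg_one_pow_eq_or ℝ (l.count v) with h | h <;> rw [h] <;> norm_num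

lemma sqrt_two_sub_one_pos : (0 : ℝ) < √2 - 1 := by
  have := Real.lt_sqrt_of_sq_lt (show (1 : ℝ) ^ 2 < 2 by norm_num)
  linarith

lemma bw_insert {E : Finset (Sym2 V)} {e : Sym2 V} (he : e ∉ E) (A : Finset V) :
    bw (insert e E) A = (1 + (√2 - 1) * edgeSpinProd (↑A) e) * bw E A :=
  Finset.prod_insert he

lemma griffiths (S : Finset V) (E : Finset (Sym2 V)) (hE : ∀ e ∈ E, ∀ v ∈ e, v ∈ S)
    (l : List V) (hl : ∀ v ∈ l, v ∈ S) :
    0 ≤ ∑ A ∈ S.powerset, bw E A * (l.map (spin (↑A))).prod := by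
  induction E using Finset.induction_on generalizing l with
  | empty =>
    simpa [bw] using spin_list_prod_sum_nonneg S l hl
  | insert e E he ih =>
    have hE' : ∀ e ∈ E, ∀ v ∈ e, v ∈ S := fun f hf => hE f (Finset.mem_insert_of_mem hf)
    have he' := hE e (Finset.mem_insert_self _ _)
    induction e using Sym2.ind with
    | _ x y =>
      have h1 := ih hE' l hl
      have h2 := ih hE' (x :: y :: l) (by
        intro v hv
        rcases List.mem_cons.1 hv with rfl | hv
        · exact he' _ (by simp)
        rcases List.mem_cons.1 hv with rfl | hv
        · exact he' _ (by simp)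
        exact hl v hv)
      have h3 := mul_nonneg sqrt_two_sub_one_pos.le h2
      have := add_nonneg h1 h3
      rw [Finset.mul_sum, ← Finset.sum_add_distrib] at this
      refine this.trans_eq (Finset.sum_congr rfl fun A _ => ?_)
      rw [bw_insert he, edgeSpinProd_mk, List.map_cons, List.map_cons, List.prod_cons,
        List.prod_cons]
      ring

lemma bw_pos (E : Finset (Sym2 V)) (A : Finset V) : 0 < bw E A := by
  refine Finset.prod_pos fun e _ => ?_
  have h2 : √2 < 2 := by
    rw [Real.sqrt_lt' (by norm_num)]
    norm_num
  have := sqrt_two_sub_one_pos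
  rcases edgeSpinProd_eq_one_or (↑A) e with h | h <;> rw [h] <;> linarith

/-- Two neighbouring spins which lie on a common square are more correlated than they would be
through their common edge alone. -/
lemma neighbour_correlation (S : Finset V) (E : Finset (Sym2 V))
    (hE : ∀ e ∈ E, ∀ v ∈ e, v ∈ S) {x y z w : V} (hxy : s(x, y) ∉ E)
    (hyz : s(y, z) ∉ insert s(x, y) E) (hzw : s(z, w) ∉ insert s(y, z) (insert s(x, y) E))
    (hwx : s(w, x) ∉ insert s(z, w) (insert s(y, z) (insert s(x, y) E)))
    (hx : x ∈ S) (hy : y ∈ S) (hz : z ∈ S) (hw : w ∈ S) {E' : Finset (Sym2 V)}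
    (hE' : E' = insert s(w, x) (insert s(z, w) (insert s(y, z) (insert s(x, y) E)))) :
    ((√2 - 1) + (1 - (√2 - 1) ^ 2) * (√2 - 1) ^ 3 / 4) * ∑ A ∈ S.powerset, bw E' A ≤
      ∑ A ∈ S.powerset, bw E' A * (spin (↑A) x * spin (↑A) y) := by
  set t : ℝ := √2 - 1 with ht
  have h2 : √2 * √2 = 2 := Real.mul_self_sqrt (by norm_num)
  have ht0 : 0 < t := sqrt_two_sub_one_pos
  have ht2 : (1 + t) ^ 2 = 2 := by rw [ht]; nlinarith
  have ht1 : t < 1 := by nlinarith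
  have hbw : ∀ A, bw E' A = (1 + t * (spin (↑A) w * spin (↑A) x)) *
      ((1 + t * (spin (↑A) z * spin (↑A) w)) * ((1 + t * (spin (↑A) y * spin (↑A) z)) *
      ((1 + t * (spin (↑A) x * spin (↑A) y)) * bw E A))) := by
    intro A
    rw [hE', bw_insert hwx, bw_insert hzw, bw_insert hyz, bw_insert hxy]
    rfl
  have hup : ∑ A ∈ S.powerset, bw E' A ≤ 4 * ∑ A ∈ S.powerset, bw E A := by
    rw [Finset.mul_sum]
    refine Finset.sum_le_sum fun A _ => ?_
    have hb : ∀ a b : V, 0 ≤ 1 + t * (spin (↑A) a * spin (↑A) b) ∧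
        1 + t * (spin (↑A) a * spin (↑A) b) ≤ 1 + t := by
      intro a b
      rcases spin_eq_one_or (↑A) a with h | h <;> rcases spin_eq_one_or (↑A) b with h' | h' <;>
        rw [h, h'] <;> constructor <;> linarith
    have h4 : (1 + t) * ((1 + t) * ((1 + t) * ((1 + t) * bw E A))) = 4 * bw E A := by
      have : (1 + t) * ((1 + t) * ((1 + t) * ((1 + t) * bw E A))) =
          (1 + t) ^ 2 * (1 + t) ^ 2 * bw E A := by ring
      rw [this, ht2]
      norm_num
    rw [hbw, ← h4]
    have hp := (bw_pos E A).le
    have k1 := hb w x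
    have k2 := hb z w
    have k3 := hb y z
    have k4 := hb x y
    have ht' : 0 ≤ 1 + t := by linarith
    gcongr
    · exact mul_nonneg k2.1 (mul_nonneg k3.1 (mul_nonneg k4.1 hp))
    · linarith [k1.2]
    · exact mul_nonneg k3.1 (mul_nonneg k4.1 hp)
    · linarith [k2.2]
    · exact mul_nonneg k4.1 hp
    · linarith [k3.2]
    · linarith [k4.2]
  have g : ∀ l : List V, (∀ v ∈ l, v ∈ S) →
      0 ≤ ∑ A ∈ S.powerset, bw E A * (l.map (spin (↑A))).prod := griffiths S E hE
  have g1 := g [x, y] (by simp [hx, hy])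
  have g2 := g [x, z] (by simp [hx, hz])
  have g3 := g [x, y, z, w] (by simp [hx, hy, hz, hw])
  have g4 := g [y, w] (by simp [hy, hw])
  have g5 := g [x, w] (by simp [hx, hw])
  have g6 := g [z, w] (by simp [hz, hw])
  have g7 := g [y, z] (by simp [hy, hz])
  simp only [List.map_cons, List.map_nil, List.prod_cons, List.prod_nil, mul_one]
    at g1 g2 g3 g4 g5 g6 g7
  have hid : ∑ A ∈ S.powerset, bw E' A * (spin (↑A) x * spin (↑A) y) -
      t * ∑ A ∈ S.powerset, bw E' A = (1 - t ^ 2) * (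
      (∑ A ∈ S.powerset, bw E A * (spin (↑A) x * spin (↑A) y)) +
      t * (∑ A ∈ S.powerset, bw E A * (spin (↑A) x * spin (↑A) z)) +
      t * (∑ A ∈ S.powerset, bw E A *
        (spin (↑A) x * (spin (↑A) y * (spin (↑A) z * spin (↑A) w)))) +
      t * (∑ A ∈ S.powerset, bw E A * (spin (↑A) y * spin (↑A) w)) +
      t ^ 2 * (∑ A ∈ S.powerset, bw E A * (spin (↑A) x * spin (↑A) w)) +
      t ^ 2 * (∑ A ∈ S.powerset, bw E A * (spin (↑A) z * spin (↑A) w)) +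
      t ^ 2 * (∑ A ∈ S.powerset, bw E A * (spin (↑A) y * spin (↑A) z)) +
      t ^ 3 * ∑ A ∈ S.powerset, bw E A) := by
    simp only [Finset.mul_sum, ← Finset.sum_add_distrib, ← Finset.sum_sub_distrib]
    refine Finset.sum_congr rfl fun A _ => ?_
    rw [hbw]
    rcases spin_eq_one_or (↑A) x with h1 | h1 <;> rcases spin_eq_one_or (↑A) y with h2 | h2 <;>
      rcases spin_eq_one_or (↑A) z with h3 | h3 <;> rcases spin_eq_one_or (↑A) w with h4 | h4 <;>
      rw [h1, h2, h3, h4] <;> ring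
  have hc : 0 ≤ 1 - t ^ 2 := by nlinarith
  have hlow : (1 - t ^ 2) * (t ^ 3 * ∑ A ∈ S.powerset, bw E A) ≤
      ∑ A ∈ S.powerset, bw E' A * (spin (↑A) x * spin (↑A) y) -
      t * ∑ A ∈ S.powerset, bw E' A := by
    rw [hid]
    refine mul_le_mul_of_nonneg_left ?_ hc
    have := mul_nonneg ht0.le g2
    have := mul_nonneg ht0.le g3
    have := mul_nonneg ht0.le g4
    have := mul_nonneg (sq_nonneg t) g5
    have := mul_nonneg (sq_nonneg t) g6
    have := mul_nonneg (sq_nonneg t) g7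
    linarith
  have hfin : (1 - t ^ 2) * t ^ 3 / 4 * ∑ A ∈ S.powerset, bw E' A ≤
      (1 - t ^ 2) * (t ^ 3 * ∑ A ∈ S.powerset, bw E A) := by
    have : 0 ≤ (1 - t ^ 2) * t ^ 3 / 4 := by positivity
    calc _ ≤ (1 - t ^ 2) * t ^ 3 / 4 * (4 * ∑ A ∈ S.powerset, bw E A) := by gcongr
      _ = _ := by ring
  linarith

/-! ## Disorder insertions on a grid -/

/-- The Boltzmann weight of a spin configuration `g` on the grid `⟦0, M⟧ × ⟦0, N⟧`. -/
noncomputable def gridWeight (M N : ℕ) (g : ℕ → ℕ → ℝ) : ℝ :=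
  (∏ j ∈ Finset.range (N + 1), ∏ k ∈ Finset.range M, (1 + (√2 - 1) * (g k j * g (k + 1) j))) *
    ∏ j ∈ Finset.range N, ∏ k ∈ Finset.range (M + 1), (1 + (√2 - 1) * (g k j * g k (j + 1)))

/-- The disorder operator: the change of weight when the couplings crossed by the horizontal
half-line going to the left from the face `(i, j)` become antiferromagnetic. The face `(i, j)`
lies between columns `i - 1` and `i` and between rows `j - 1` and `j`. -/
noncomputable def disorder (N i : ℕ) : ℕ → (ℕ → ℕ → ℝ) → ℝ
  | 0, _ => 1
  | j + 1, g => if j < N then ∏ k ∈ Finset.range i, (√2 - g k j * g k (j + 1)) else 1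

/-- Flip the spins of row `j₀` lying in the first `i` columns. -/
noncomputable def flipRow (i j₀ : ℕ) (g : ℕ → ℕ → ℝ) (k j : ℕ) : ℝ :=
  if j = j₀ ∧ k < i then -g k j else g k j

lemma sq_sqrt_two : √2 * √2 = (2 : ℝ) := Real.mul_self_sqrt (by norm_num)

lemma antiferro_factor {a b : ℝ} (ha : a = 1 ∨ a = -1) (hb : b = 1 ∨ b = -1) :
    1 + (√2 - 1) * (-(a * b)) = (1 + (√2 - 1) * (a * b)) * (√2 - a * b) := by
  have := sq_sqrt_two
  rcases ha with rfl | rfl <;> rcases hb with rfl | rfl <;> nlinarith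

lemma disorder_factor_mul {a b : ℝ} (ha : a = 1 ∨ a = -1) (hb : b = 1 ∨ b = -1) :
    (√2 - -(a * b)) * (√2 - a * b) = 1 := by
  have := sq_sqrt_two
  rcases ha with rfl | rfl <;> rcases hb with rfl | rfl <;> nlinarith

lemma prod_range_range_ite (N K i j₀ : ℕ) (hi : i ≤ K) (f : ℕ → ℕ → ℝ) :
    (∏ j ∈ Finset.range N, ∏ k ∈ Finset.range K, if j = j₀ ∧ k < i then f k j else 1) =
      if j₀ < N then ∏ k ∈ Finset.range i, f k j₀ else 1 := by
  have h : ∀ j ∈ Finset.range N,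
      (∏ k ∈ Finset.range K, if j = j₀ ∧ k < i then f k j else 1) =
      if j = j₀ then ∏ k ∈ Finset.range i, f k j₀ else 1 := by
    intro j _
    by_cases hj : j = j₀
    · subst hj
      simp only [true_and, if_true]
      rw [← Finset.prod_filter]
      congr 1
      ext k
      simp only [Finset.mem_filter, Finset.mem_range]
      omega
    · simp [hj]
  rw [Finset.prod_congr rfl h, Finset.prod_ite_eq']
  simp

lemma gridWeight_flipRow (M N i j₀ : ℕ) (hi : i ≤ M) (hj : j₀ ≤ N) (g : ℕ → ℕ → ℝ)
    (hg : ∀ k j, g k j = 1 ∨ g k j = -1) :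
    gridWeight M N (flipRow (i + 1) j₀ g) = gridWeight M N g *
      (disorder N (i + 1) j₀ g * disorder N (i + 1) (j₀ + 1) g *
        if i < M then √2 - g i j₀ * g (i + 1) j₀ else 1) := by
  have hh : ∀ k j, 1 + (√2 - 1) * (flipRow (i + 1) j₀ g k j * flipRow (i + 1) j₀ g (k + 1) j) =
      (1 + (√2 - 1) * (g k j * g (k + 1) j)) *
        if j = j₀ then (if k = i then √2 - g k j * g (k + 1) j else 1) else 1 := by
    intro k j
    unfold flipRow
    by_cases h1 : j = j₀
    · subst h1
      rcases lt_trichotomy k i with h2 | h2 | h2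
      · rw [if_pos (by omega), if_pos (by omega), if_pos rfl, if_neg (by omega)]
        ring
      · rw [if_pos (by omega), if_neg (by omega), if_pos rfl, if_pos h2, neg_mul,
          antiferro_factor (hg _ _) (hg _ _)]
      · rw [if_neg (by omega), if_neg (by omega), if_pos rfl, if_neg (by omega)]
        ring
    · rw [if_neg (by omega), if_neg (by omega), if_neg h1]
      ring
  have hv : ∀ k j, 1 + (√2 - 1) * (flipRow (i + 1) j₀ g k j * flipRow (i + 1) j₀ g k (j + 1)) =
      (1 + (√2 - 1) * (g k j * g k (j + 1))) *
        ((if j + 1 = j₀ ∧ k < i + 1 then √2 - g k j * g k (j + 1) else 1) *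
        (if j = j₀ ∧ k < i + 1 then √2 - g k j * g k (j + 1) else 1)) := by
    intro k j
    unfold flipRow
    by_cases h1 : k < i + 1
    · by_cases h2 : j = j₀
      · rw [if_pos ⟨h2, h1⟩, if_neg (by omega), if_neg (by omega), if_pos ⟨h2, h1⟩, neg_mul,
          antiferro_factor (hg _ _) (hg _ _)]
        ring
      · by_cases h3 : j + 1 = j₀
        · rw [if_neg (by omega), if_pos ⟨h3, h1⟩, if_pos ⟨h3, h1⟩, if_neg (by omega), mul_neg,
            antiferro_factor (hg _ _) (hg _ _)]
          ring
        · rw [if_neg (by omega), if_neg (by omega), if_neg (by omega), if_neg (by omega)]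
          ring
    · rw [if_neg (by omega), if_neg (by omega), if_neg (by omega), if_neg (by omega)]
      ring
  have hdn : (∏ j ∈ Finset.range N, ∏ k ∈ Finset.range (M + 1),
      if j + 1 = j₀ ∧ k < i + 1 then √2 - g k j * g k (j + 1) else 1) =
      disorder N (i + 1) j₀ g := by
    cases j₀ with
    | zero => simp [disorder]
    | succ j' =>
      simp only [add_left_inj]
      rw [prod_range_range_ite N (M + 1) (i + 1) j' (by omega)
        (fun k j => √2 - g k j * g k (j + 1))]
      rfl
  have hup : (∏ j ∈ Finset.range N, ∏ k ∈ Finset.range (M + 1),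
      if j = j₀ ∧ k < i + 1 then √2 - g k j * g k (j + 1) else 1) =
      disorder N (i + 1) (j₀ + 1) g := by
    rw [prod_range_range_ite N (M + 1) (i + 1) j₀ (by omega)
      (fun k j => √2 - g k j * g k (j + 1))]
    rfl
  have hmid : (∏ j ∈ Finset.range (N + 1), ∏ k ∈ Finset.range M,
      if j = j₀ then (if k = i then √2 - g k j * g (k + 1) j else 1) else 1) =
      if i < M then √2 - g i j₀ * g (i + 1) j₀ else 1 := by
    rw [Finset.prod_eq_single j₀]
    · simp only [if_true]
      rw [Finset.prod_ite_eq']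
      simp
    · intro j _ hj
      simp [hj]
    · intro h
      exact absurd (Finset.mem_range.2 (by omega)) h
  unfold gridWeight
  simp only [hh, hv, Finset.prod_mul_distrib, hdn, hup, hmid]
  ring

lemma disorder_flipRow_self (N i j₀ j : ℕ) (hj : j = j₀ ∨ j = j₀ + 1) (g : ℕ → ℕ → ℝ)
    (hg : ∀ k j, g k j = 1 ∨ g k j = -1) :
    disorder N i j (flipRow i j₀ g) * disorder N i j g = 1 := by
  cases j with
  | zero => simp [disorder]
  | succ j =>
    simp only [disorder]
    split_ifs with h
    · rw [← Finset.prod_mul_distrib]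
      refine Finset.prod_eq_one fun k hk => ?_
      have hk := Finset.mem_range.1 hk
      have : flipRow i j₀ g k j * flipRow i j₀ g k (j + 1) = -(g k j * g k (j + 1)) := by
        unfold flipRow
        rcases hj with hj | hj
        · rw [if_neg (by omega), if_pos ⟨hj, hk⟩]
          ring
        · rw [if_pos ⟨by omega, hk⟩, if_neg (by omega)]
          ring
      rw [this, disorder_factor_mul (hg _ _) (hg _ _)]
    · norm_num

lemma disorder_top (N i : ℕ) (g : ℕ → ℕ → ℝ) : disorder N i (N + 1) g = 1 := by
  simp [disorder]

lemma disorder_left (N j : ℕ) (g : ℕ → ℕ → ℝ) : disorder N 0 j g = 1 := by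
  cases j <;> simp [disorder]

lemma disorder_step (N i j : ℕ) (hj : j < N) (g : ℕ → ℕ → ℝ) :
    disorder N (i + 1) (j + 1) g =
      disorder N i (j + 1) g * (√2 - g i j * g i (j + 1)) := by
  simp [disorder, hj, Finset.prod_range_succ]

/-- The fermionic observable `⟨σ_{(c,N)} σ_{(a,b)} μ_{(i,j)}⟩`, where `(a, b)` is a site and
`(i, j)` a face. -/
noncomputable def obs {ι : Type*} (s : Finset ι) (g : ι → ℕ → ℕ → ℝ) (M N c a b i j : ℕ) : ℝ :=
  ∑ A ∈ s, gridWeight M N (g A) * (g A c N * g A a b) * disorder N i j (g A)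

/-- The index set `s` enumerates a family of spin configurations which is stable under the
flips of partial rows. -/
structure FlipStable {ι : Type*} (s : Finset ι) (g : ι → ℕ → ℕ → ℝ) (M N : ℕ) : Prop where
  spin : ∀ A k j, g A k j = 1 ∨ g A k j = -1
  flip : ∀ i j, i ≤ M → j ≤ N → ∀ F : (ℕ → ℕ → ℝ) → ℝ,
    ∑ A ∈ s, F (flipRow (i + 1) j (g A)) = ∑ A ∈ s, F (g A)

section

variable {ι : Type*} {s : Finset ι} {g : ι → ℕ → ℕ → ℝ} {M N : ℕ}

lemma obs_flip (hs : FlipStable s g M N) (c a i j p q : ℕ) (hi : i ≤ M) (hj : j ≤ N)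
    (hpq : p = j ∧ q = j + 1 ∨ p = j + 1 ∧ q = j) :
    ∃ ε : ℝ, ε ^ 2 = 1 ∧ obs s g M N c a j (i + 1) q =
      ε * ∑ A ∈ s, gridWeight M N (g A) * (g A c N * g A a j) * disorder N (i + 1) p (g A) *
        if i < M then √2 - g A i j * g A (i + 1) j else 1 := by
  refine ⟨(if N = j ∧ c < i + 1 then -1 else 1) * (if j = j ∧ a < i + 1 then -1 else 1), ?_, ?_⟩
  · split_ifs <;> norm_num
  · unfold obs
    rw [← hs.flip i j hi hj (fun h => gridWeight M N h * (h c N * h a j) *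
      disorder N (i + 1) q h), Finset.mul_sum]
    refine Finset.sum_congr rfl fun A _ => ?_
    have hD := disorder_flipRow_self N (i + 1) j q (by omega) (g A) (hs.spin A)
    have hW := gridWeight_flipRow M N i j hi hj (g A) (hs.spin A)
    have hpq' : disorder N (i + 1) j (g A) * disorder N (i + 1) (j + 1) (g A) =
        disorder N (i + 1) p (g A) * disorder N (i + 1) q (g A) := by
      rcases hpq with ⟨rfl, rfl⟩ | ⟨rfl, rfl⟩ <;> ring
    rw [hW, hpq']
    have e1 : flipRow (i + 1) j (g A) c N = (if N = j ∧ c < i + 1 then -1 else 1) * g A c N := by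
      unfold flipRow; split_ifs <;> ring
    have e2 : flipRow (i + 1) j (g A) a j = (if j = j ∧ a < i + 1 then -1 else 1) * g A a j := by
      unfold flipRow; split_ifs <;> ring
    rw [e1, e2]
    linear_combination (gridWeight M N (g A) * disorder N (i + 1) p (g A) *
      (if i < M then √2 - g A i j * g A (i + 1) j else 1) *
      ((if N = j ∧ c < i + 1 then -1 else 1) * g A c N) *
      ((if j = j ∧ a < i + 1 then -1 else 1) * g A a j)) * hD

lemma FlipStable.sq (hs : FlipStable s g M N) (A : ι) (k j : ℕ) : g A k j * g A k j = 1 := by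
  rcases hs.spin A k j with h | h <;> rw [h] <;> norm_num

lemma obs_horizontal_left (hs : FlipStable s g M N) (c i j p q : ℕ) (hi : i < M) (hj : j ≤ N)
    (hpq : p = j ∧ q = j + 1 ∨ p = j + 1 ∧ q = j) :
    obs s g M N c i j (i + 1) q ^ 2 =
      (√2 * obs s g M N c i j (i + 1) p - obs s g M N c (i + 1) j (i + 1) p) ^ 2 := by
  obtain ⟨ε, hε, h⟩ := obs_flip hs c i i j p q hi.le hj hpq
  rw [h, mul_pow, hε, one_mul]
  unfold obs
  rw [Finset.mul_sum, ← Finset.sum_sub_distrib]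
  congr 1
  refine Finset.sum_congr rfl fun A _ => ?_
  rw [if_pos hi]
  linear_combination (-gridWeight M N (g A) * g A c N * disorder N (i + 1) p (g A) *
    g A (i + 1) j) * hs.sq A i j

lemma obs_horizontal_right (hs : FlipStable s g M N) (c i j p q : ℕ) (hi : i < M) (hj : j ≤ N)
    (hpq : p = j ∧ q = j + 1 ∨ p = j + 1 ∧ q = j) :
    obs s g M N c (i + 1) j (i + 1) q ^ 2 =
      (√2 * obs s g M N c (i + 1) j (i + 1) p - obs s g M N c i j (i + 1) p) ^ 2 := by
  obtain ⟨ε, hε, h⟩ := obs_flip hs c (i + 1) i j p q hi.le hj hpq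
  rw [h, mul_pow, hε, one_mul]
  unfold obs
  rw [Finset.mul_sum, ← Finset.sum_sub_distrib]
  congr 1
  refine Finset.sum_congr rfl fun A _ => ?_
  rw [if_pos hi]
  linear_combination (-gridWeight M N (g A) * g A c N * disorder N (i + 1) p (g A) *
    g A i j) * hs.sq A (i + 1) j

lemma obs_outer_right (hs : FlipStable s g M N) (c a j : ℕ) (hj : j ≤ N) :
    obs s g M N c a j (M + 1) (j + 1) ^ 2 = obs s g M N c a j (M + 1) j ^ 2 := by
  obtain ⟨ε, hε, h⟩ := obs_flip hs c a M j j (j + 1) le_rfl hj (by simp)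
  rw [h, mul_pow, hε, one_mul]
  simp [obs]

lemma obs_vertical_lower (hs : FlipStable s g M N) (c i j : ℕ) (hj : j < N) :
    obs s g M N c i j (i + 1) (j + 1) =
      √2 * obs s g M N c i j i (j + 1) - obs s g M N c i (j + 1) i (j + 1) := by
  unfold obs
  rw [Finset.mul_sum, ← Finset.sum_sub_distrib]
  refine Finset.sum_congr rfl fun A _ => ?_
  rw [disorder_step N i j hj]
  linear_combination (-gridWeight M N (g A) * g A c N * disorder N i (j + 1) (g A) *
    g A i (j + 1)) * hs.sq A i j

lemma obs_vertical_upper (hs : FlipStable s g M N) (c i j : ℕ) (hj : j < N) :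
    obs s g M N c i (j + 1) (i + 1) (j + 1) =
      √2 * obs s g M N c i (j + 1) i (j + 1) - obs s g M N c i j i (j + 1) := by
  unfold obs
  rw [Finset.mul_sum, ← Finset.sum_sub_distrib]
  refine Finset.sum_congr rfl fun A _ => ?_
  rw [disorder_step N i j hj]
  linear_combination (-gridWeight M N (g A) * g A c N * disorder N i (j + 1) (g A) *
    g A i j) * hs.sq A i (j + 1)

lemma obs_top_eq (c a b i i' : ℕ) :
    obs s g M N c a b i (N + 1) = obs s g M N c a b i' (N + 1) := by
  simp [obs, disorder_top]

lemma obs_bottom_eq (c a b i i' : ℕ) : obs s g M N c a b i 0 = obs s g M N c a b i' 0 := by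
  simp [obs, disorder]

lemma obs_left_eq (c a b j j' : ℕ) : obs s g M N c a b 0 j = obs s g M N c a b 0 j' := by
  simp [obs, disorder_left]

/-- The discrete primitive of the square of the observable, on the faces of the grid. -/
noncomputable def primitive (s : Finset ι) (g : ι → ℕ → ℕ → ℝ) (M N c i j : ℕ) : ℝ :=
  ∑ k ∈ Finset.range i,
    (obs s g M N c k (j - 1) k j ^ 2 - obs s g M N c k (j - 1) (k + 1) j ^ 2)

lemma primitive_left (c j : ℕ) : primitive s g M N c 0 j = 0 := by simp [primitive]

lemma primitive_bottom (c i : ℕ) : primitive s g M N c i 0 = 0 := by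
  refine Finset.sum_eq_zero fun k _ => ?_
  rw [obs_bottom_eq c k (0 - 1) k (k + 1), sub_self]

lemma primitive_top (c i : ℕ) : primitive s g M N c i (N + 1) = 0 := by
  refine Finset.sum_eq_zero fun k _ => ?_
  rw [obs_top_eq c k (N + 1 - 1) k (k + 1), sub_self]

lemma primitive_succ_lower (c i j : ℕ) :
    primitive s g M N c (i + 1) (j + 1) - primitive s g M N c i (j + 1) =
      obs s g M N c i j i (j + 1) ^ 2 - obs s g M N c i j (i + 1) (j + 1) ^ 2 := by
  simp only [primitive, Finset.sum_range_succ, Nat.add_sub_cancel]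
  ring

lemma primitive_succ_upper (hs : FlipStable s g M N) (c i j : ℕ) (hj : j ≤ N) :
    primitive s g M N c (i + 1) j - primitive s g M N c i j =
      obs s g M N c i j i j ^ 2 - obs s g M N c i j (i + 1) j ^ 2 := by
  cases j with
  | zero => rw [primitive_bottom, primitive_bottom, obs_bottom_eq c i 0 i (i + 1)]; ring
  | succ j =>
    rw [primitive_succ_lower, obs_vertical_lower hs c i j hj, obs_vertical_upper hs c i j hj]
    linear_combination (obs s g M N c i (j + 1) i (j + 1) ^ 2 -
      obs s g M N c i j i (j + 1) ^ 2) * sq_sqrt_two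

lemma primitive_vertical_aux (hs : FlipStable s g M N) (c i j : ℕ) (hi : i ≤ M) (hj : j ≤ N) :
    primitive s g M N c i (j + 1) - primitive s g M N c i j =
      obs s g M N c i j i j ^ 2 - obs s g M N c i j i (j + 1) ^ 2 ∧
    primitive s g M N c (i + 1) (j + 1) - primitive s g M N c (i + 1) j =
      obs s g M N c i j (i + 1) j ^ 2 - obs s g M N c i j (i + 1) (j + 1) ^ 2 := by
  induction i with
  | zero =>
    have h0 : primitive s g M N c 0 (j + 1) - primitive s g M N c 0 j =
        obs s g M N c 0 j 0 j ^ 2 - obs s g M N c 0 j 0 (j + 1) ^ 2 := by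
      rw [primitive_left, primitive_left, obs_left_eq c 0 j j (j + 1)]; ring
    refine ⟨h0, ?_⟩
    have h1 := primitive_succ_lower (s := s) (g := g) (M := M) (N := N) c 0 j
    have h2 := primitive_succ_upper hs c 0 j hj
    linarith
  | succ i ih =>
    have h0 : primitive s g M N c (i + 1) (j + 1) - primitive s g M N c (i + 1) j =
        obs s g M N c (i + 1) j (i + 1) j ^ 2 - obs s g M N c (i + 1) j (i + 1) (j + 1) ^ 2 := by
      rw [(ih (by omega)).2,
        obs_horizontal_left hs c i j j (j + 1) (by omega) hj (by simp),
        obs_horizontal_right hs c i j j (j + 1) (by omega) hj (by simp)]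
      linear_combination (obs s g M N c (i + 1) j (i + 1) j ^ 2 -
        obs s g M N c i j (i + 1) j ^ 2) * sq_sqrt_two
    refine ⟨h0, ?_⟩
    have h1 := primitive_succ_lower (s := s) (g := g) (M := M) (N := N) c (i + 1) j
    have h2 := primitive_succ_upper hs c (i + 1) j hj
    linarith

lemma primitive_vertical (hs : FlipStable s g M N) (c i j : ℕ) (hi : i ≤ M) (hj : j ≤ N) :
    primitive s g M N c (i + 1) (j + 1) - primitive s g M N c (i + 1) j =
      obs s g M N c i j (i + 1) j ^ 2 - obs s g M N c i j (i + 1) (j + 1) ^ 2 :=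
  (primitive_vertical_aux hs c i j hi hj).2

lemma primitive_right (hs : FlipStable s g M N) (c j : ℕ) (hj : j ≤ N + 1) :
    primitive s g M N c (M + 1) j = 0 := by
  induction j with
  | zero => exact primitive_bottom c _
  | succ j ih =>
    have h := primitive_vertical hs c M j le_rfl (by omega)
    rw [obs_outer_right hs c M j (by omega), ih (by omega)] at h
    linarith

/-- The discrete primitive is superharmonic on the faces. -/
lemma primitive_superharmonic (hs : FlipStable s g M N) (c i j : ℕ) (hi : i < M) (hj : j < N) :
    primitive s g M N c (i + 2) (j + 1) + primitive s g M N c i (j + 1) +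
      primitive s g M N c (i + 1) (j + 2) + primitive s g M N c (i + 1) j ≤
      4 * primitive s g M N c (i + 1) (j + 1) := by
  have r1 := primitive_succ_lower (s := s) (g := g) (M := M) (N := N) c (i + 1) j
  have r2 := primitive_succ_lower (s := s) (g := g) (M := M) (N := N) c i j
  have r3 := primitive_vertical hs c i (j + 1) hi.le hj
  have r4 := primitive_vertical hs c i j hi.le hj.le
  rw [obs_vertical_lower hs c (i + 1) j hj] at r1
  rw [obs_horizontal_left hs c i (j + 1) (j + 1) (j + 1 + 1) hi hj (by simp)] at r3
  rw [obs_horizontal_left hs c i j (j + 1) j hi hj.le (by simp)] at r4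
  have u1 := obs_vertical_lower hs c i j hj
  have u2 := obs_vertical_upper hs c i j hj
  have hl : obs s g M N c i j i (j + 1) =
      √2 * obs s g M N c i j (i + 1) (j + 1) + obs s g M N c i (j + 1) (i + 1) (j + 1) := by
    rw [u1, u2]
    linear_combination (-obs s g M N c i j i (j + 1)) * sq_sqrt_two
  rw [hl] at r2
  set a₁ := obs s g M N c i j (i + 1) (j + 1)
  set a₂ := obs s g M N c (i + 1) j (i + 1) (j + 1)
  set a₃ := obs s g M N c (i + 1) (j + 1) (i + 1) (j + 1)
  set a₄ := obs s g M N c i (j + 1) (i + 1) (j + 1)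
  have k1 := sq_nonneg (√2 * a₂ - (a₁ + a₃))
  have k2 := sq_nonneg (√2 * a₄ - (a₃ - a₁))
  have h2 := sq_sqrt_two
  have e1 : (√2 * a₂ - a₃) ^ 2 = 2 * a₂ ^ 2 - 2 * √2 * a₂ * a₃ + a₃ ^ 2 := by
    linear_combination a₂ ^ 2 * h2
  have e2 : (√2 * a₁ + a₄) ^ 2 = 2 * a₁ ^ 2 + 2 * √2 * a₁ * a₄ + a₄ ^ 2 := by
    linear_combination a₁ ^ 2 * h2
  have e3 : (√2 * a₄ - a₃) ^ 2 = 2 * a₄ ^ 2 - 2 * √2 * a₄ * a₃ + a₃ ^ 2 := by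
    linear_combination a₄ ^ 2 * h2
  have e4 : (√2 * a₁ - a₂) ^ 2 = 2 * a₁ ^ 2 - 2 * √2 * a₁ * a₂ + a₂ ^ 2 := by
    linear_combination a₁ ^ 2 * h2
  have f1 : (√2 * a₂ - (a₁ + a₃)) ^ 2 =
      2 * a₂ ^ 2 - 2 * √2 * a₂ * (a₁ + a₃) + (a₁ + a₃) ^ 2 := by
    linear_combination a₂ ^ 2 * h2
  have f2 : (√2 * a₄ - (a₃ - a₁)) ^ 2 =
      2 * a₄ ^ 2 - 2 * √2 * a₄ * (a₃ - a₁) + (a₃ - a₁) ^ 2 := by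
    linear_combination a₄ ^ 2 * h2
  rw [e1] at r1
  rw [e2] at r2
  rw [e3] at r3
  rw [e4] at r4
  rw [f1] at k1
  rw [f2] at k2
  norm_num [add_assoc] at r1 r3 r4 ⊢
  nlinarith

/-- The primitive on a face of the bottom row is at most the square of the spin correlation at
the boundary site below. -/
lemma primitive_bottom_row_le (hs : FlipStable s g M N) (c i : ℕ) (hi : i ≤ M) :
    primitive s g M N c (i + 1) 1 ≤
      (∑ A ∈ s, gridWeight M N (g A) * (g A c N * g A i 0)) ^ 2 := by
  have h := primitive_vertical hs c i 0 hi (Nat.zero_le _)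
  rw [primitive_bottom] at h
  have h' : obs s g M N c i 0 (i + 1) 0 =
      ∑ A ∈ s, gridWeight M N (g A) * (g A c N * g A i 0) := by
    simp [obs, disorder]
  rw [← h']
  have := sq_nonneg (obs s g M N c i 0 (i + 1) (0 + 1))
  simp only [zero_add] at h this
  linarith

/-- The primitive on the face of the top row next to the source. -/
lemma primitive_source (hs : FlipStable s g M N) (c : ℕ) (hc : c < M) :
    primitive s g M N c (c + 1) N = (∑ A ∈ s, gridWeight M N (g A)) ^ 2 -
      (√2 * (∑ A ∈ s, gridWeight M N (g A)) -
        ∑ A ∈ s, gridWeight M N (g A) * (g A c N * g A (c + 1) N)) ^ 2 := by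
  have h := primitive_vertical hs c c N hc.le le_rfl
  rw [primitive_top, obs_horizontal_left hs c c N (N + 1) N hc le_rfl (by simp)] at h
  have h1 : obs s g M N c c N (c + 1) (N + 1) = ∑ A ∈ s, gridWeight M N (g A) := by
    simp [obs, disorder_top, hs.sq]
  have h2 : obs s g M N c (c + 1) N (c + 1) (N + 1) =
      ∑ A ∈ s, gridWeight M N (g A) * (g A c N * g A (c + 1) N) := by
    simp [obs, disorder_top]
  rw [h1, h2] at h
  linarith

end

/-! ## Discrete superharmonic functions on rectangles -/

/-- Discrete superharmonicity in the interior of the rectangle `⟦a, b⟧ × ⟦c, d⟧`. -/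
def SuperharmonicOn (F : ℤ → ℤ → ℝ) (a b c d : ℤ) : Prop :=
  ∀ i j, a < i → i < b → c < j → j < d →
    F (i + 1) j + F (i - 1) j + F i (j + 1) + F i (j - 1) ≤ 4 * F i j

lemma SuperharmonicOn.nonneg {F : ℤ → ℤ → ℝ} {a b c d : ℤ} (hF : SuperharmonicOn F a b c d)
    (hbd : ∀ i j, a ≤ i → i ≤ b → c ≤ j → j ≤ d → (i = a ∨ i = b ∨ j = c ∨ j = d) → 0 ≤ F i j)
    {i j : ℤ} (hai : a ≤ i) (hib : i ≤ b) (hcj : c ≤ j) (hjd : j ≤ d) : 0 ≤ F i j := by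
  set R := Finset.Icc a b ×ˢ Finset.Icc c d with hR
  have hmem : ∀ p : ℤ × ℤ, p ∈ R ↔ (a ≤ p.1 ∧ p.1 ≤ b) ∧ c ≤ p.2 ∧ p.2 ≤ d := by
    intro p
    simp [hR]
  have hij : (i, j) ∈ R := (hmem _).2 ⟨⟨hai, hib⟩, hcj, hjd⟩
  obtain ⟨p, hp, hpmin⟩ := R.exists_min_image (fun p => F p.1 p.2) ⟨_, hij⟩
  by_contra! hneg
  have hpneg : F p.1 p.2 < 0 := (hpmin _ hij).trans_lt hneg
  obtain ⟨q, hq, hqmin⟩ := (R.filter fun q => F q.1 q.2 = F p.1 p.2).exists_min_image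
    (fun q => q.1) ⟨p, Finset.mem_filter.2 ⟨hp, rfl⟩⟩
  obtain ⟨hqR, hqp⟩ := Finset.mem_filter.1 hq
  obtain ⟨⟨h1, h2⟩, h3, h4⟩ := (hmem q).1 hqR
  have hint : ¬(q.1 = a ∨ q.1 = b ∨ q.2 = c ∨ q.2 = d) := by
    intro h
    have := hbd q.1 q.2 h1 h2 h3 h4 h
    linarith
  have hs := hF q.1 q.2 (by omega) (by omega) (by omega) (by omega)
  have hmin : ∀ x y : ℤ, a ≤ x → x ≤ b → c ≤ y → y ≤ d → F p.1 p.2 ≤ F x y :=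
    fun x y hx hx' hy hy' => hpmin (x, y) ((hmem _).2 ⟨⟨hx, hx'⟩, hy, hy'⟩)
  have k1 := hmin (q.1 + 1) q.2 (by omega) (by omega) (by omega) (by omega)
  have k2 := hmin (q.1 - 1) q.2 (by omega) (by omega) (by omega) (by omega)
  have k3 := hmin q.1 (q.2 + 1) (by omega) (by omega) (by omega) (by omega)
  have k4 := hmin q.1 (q.2 - 1) (by omega) (by omega) (by omega) (by omega)
  have := hqmin (q.1 - 1, q.2) (Finset.mem_filter.2
    ⟨(hmem _).2 ⟨⟨by simp only; omega, by simp only; omega⟩, h3, h4⟩, by simp only; linarith⟩)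
  simp only at this
  omega

lemma SuperharmonicOn.mono {F : ℤ → ℤ → ℝ} {a b c d a' b' c' d' : ℤ}
    (hF : SuperharmonicOn F a b c d) (ha : a ≤ a') (hb : b' ≤ b) (hc : c ≤ c') (hd : d' ≤ d) :
    SuperharmonicOn F a' b' c' d' := fun i j h1 h2 h3 h4 =>
  hF i j (by omega) (by omega) (by omega) (by omega)

/-- The comparison principle. -/
lemma SuperharmonicOn.le {F G : ℤ → ℤ → ℝ} {a b c d : ℤ} (hF : SuperharmonicOn F a b c d)
    (hG : ∀ i j, G (i + 1) j + G (i - 1) j + G i (j + 1) + G i (j - 1) = 4 * G i j)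
    (hbd : ∀ i j, a ≤ i → i ≤ b → c ≤ j → j ≤ d → (i = a ∨ i = b ∨ j = c ∨ j = d) →
      G i j ≤ F i j)
    {i j : ℤ} (hai : a ≤ i) (hib : i ≤ b) (hcj : c ≤ j) (hjd : j ≤ d) : G i j ≤ F i j := by
  have hS : SuperharmonicOn (fun i j => F i j - G i j) a b c d := by
    intro i j h1 h2 h3 h4
    have := hF i j h1 h2 h3 h4
    have := hG i j
    simp only
    linarith
  have := hS.nonneg (fun i j h1 h2 h3 h4 h => sub_nonneg.2 (hbd i j h1 h2 h3 h4 h)) hai hib hcj hjd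
  exact sub_nonneg.1 this

/-- The decay rate of discrete harmonic functions with horizontal frequency `θ`. -/
lemma exists_rate {θ : ℝ} (h0 : 0 < θ) (hπ : θ < Real.pi) :
    ∃ r : ℝ, 0 < r ∧ r ≤ θ ∧ Real.cosh r = 2 - Real.cos θ := by
  have hcos : Real.cos θ < 1 := by
    rw [← Real.cos_zero]
    exact Real.cos_lt_cos_of_nonneg_of_le_pi le_rfl hπ.le h0
  have hle : 2 - Real.cos θ ≤ Real.cosh θ := by
    have h1 := Real.one_sub_sq_div_two_le_cos (x := θ)
    have h2 : Real.cosh θ = 1 + 2 * Real.sinh (θ / 2) ^ 2 := by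
      have := Real.cosh_two_mul (θ / 2)
      rw [mul_div_cancel₀ θ two_ne_zero, Real.cosh_sq] at this
      linarith
    have h3 : θ / 2 ≤ Real.sinh (θ / 2) := Real.self_le_sinh_iff.2 (by linarith)
    nlinarith
  obtain ⟨r, hr, hr'⟩ := intermediate_value_Icc h0.le Real.continuous_cosh.continuousOn
    (show 2 - Real.cos θ ∈ Set.Icc (Real.cosh 0) (Real.cosh θ) from
      ⟨by rw [Real.cosh_zero]; linarith, hle⟩)
  refine ⟨r, lt_of_le_of_ne hr.1 ?_, hr.2, hr'⟩
  rintro rfl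
  rw [Real.cosh_zero] at hr'
  linarith

lemma cos_mul_sinh_harmonic {θ r : ℝ} (h : Real.cosh r = 2 - Real.cos θ) (φ : ℝ) (i j : ℤ) :
    Real.cos (θ * ((i + 1 : ℤ) : ℝ) + φ) * Real.sinh (r * (j : ℝ)) +
      Real.cos (θ * ((i - 1 : ℤ) : ℝ) + φ) * Real.sinh (r * (j : ℝ)) +
      Real.cos (θ * (i : ℝ) + φ) * Real.sinh (r * ((j + 1 : ℤ) : ℝ)) +
      Real.cos (θ * (i : ℝ) + φ) * Real.sinh (r * ((j - 1 : ℤ) : ℝ)) =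
    4 * (Real.cos (θ * (i : ℝ) + φ) * Real.sinh (r * (j : ℝ))) := by
  have e1 : θ * ((i + 1 : ℤ) : ℝ) + φ = (θ * (i : ℝ) + φ) + θ := by push_cast; ring
  have e2 : θ * ((i - 1 : ℤ) : ℝ) + φ = (θ * (i : ℝ) + φ) - θ := by push_cast; ring
  have e3 : r * ((j + 1 : ℤ) : ℝ) = r * (j : ℝ) + r := by push_cast; ring
  have e4 : r * ((j - 1 : ℤ) : ℝ) = r * (j : ℝ) - r := by push_cast; ring
  rw [e1, e2, e3, e4, Real.cos_add, Real.cos_sub, Real.sinh_add, Real.sinh_sub]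
  linear_combination (2 * Real.cos (θ * (i : ℝ) + φ) * Real.sinh (r * (j : ℝ))) * h

lemma sinh_le_self_mul_cosh {x : ℝ} (hx : 0 ≤ x) : Real.sinh x ≤ x * Real.cosh x := by
  have hmono : MonotoneOn (fun y => y * Real.cosh y - Real.sinh y) (Set.Ici 0) := by
    refine monotoneOn_of_deriv_nonneg (convex_Ici 0) (by fun_prop) (by fun_prop) ?_
    intro y hy
    rw [interior_Ici] at hy
    have hd : HasDerivAt (fun y => y * Real.cosh y - Real.sinh y)
        (1 * Real.cosh y + y * Real.sinh y - Real.cosh y) y :=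
      ((hasDerivAt_id y).mul (Real.hasDerivAt_cosh y)).sub (Real.hasDerivAt_sinh y)
    rw [hd.deriv]
    have := mul_nonneg (le_of_lt hy) (Real.sinh_nonneg_iff.2 (le_of_lt hy))
    linarith
  have := hmono Set.self_mem_Ici hx hx
  simp only [zero_mul, Real.sinh_zero, sub_zero] at this
  linarith

lemma div_div_cosh_le_sinh_div_sinh {r θ j J : ℝ} (hr : 0 < r) (hrθ : r ≤ θ) (hj : 0 ≤ j)
    (hJ : 0 < J) :
    j / J / Real.cosh (θ * J) ≤ Real.sinh (r * j) / Real.sinh (r * J) := by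
  have hrJ : 0 < r * J := mul_pos hr hJ
  have hs : 0 < Real.sinh (r * J) := Real.sinh_pos_iff.2 hrJ
  have h1 : r * j ≤ Real.sinh (r * j) := Real.self_le_sinh_iff.2 (by positivity)
  have h2 := sinh_le_self_mul_cosh hrJ.le
  have h3 : Real.cosh (r * J) ≤ Real.cosh (θ * J) := by
    rw [Real.cosh_le_cosh, abs_of_pos hrJ, abs_of_pos (by nlinarith)]
    gcongr
  have hc : 0 < Real.cosh (θ * J) := Real.cosh_pos _
  rw [div_div, div_le_div_iff₀ (by positivity) hs]
  calc j * Real.sinh (r * J) ≤ j * (r * J * Real.cosh (θ * J)) := by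
        gcongr
        exact h2.trans (by gcongr)
    _ = (r * j) * (J * Real.cosh (θ * J)) := by ring
    _ ≤ Real.sinh (r * j) * (J * Real.cosh (θ * J)) := by gcongr

/-- A superharmonic function dominating a sine arch on one side of a rectangle. -/
lemma SuperharmonicOn.ge_of_arch {F : ℤ → ℤ → ℝ} {L J : ℤ} (hL : 1 < L) (hJ : 0 < J)
    (hF : SuperharmonicOn F 0 L 0 J)
    (h0 : ∀ i j, 0 ≤ i → i ≤ L → 0 ≤ j → j ≤ J → 0 ≤ F i j) {η : ℝ} (hη : 0 ≤ η)
    (htop : ∀ i, 0 ≤ i → i ≤ L → η * Real.sin (Real.pi * i / L) ≤ F i J)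
    {i j : ℤ} (hi : 0 ≤ i) (hiL : i ≤ L) (hj : 0 ≤ j) (hjJ : j ≤ J) :
    η * Real.sin (Real.pi * i / L) * (j / J / Real.cosh (Real.pi / L * J)) ≤ F i j := by
  have hL' : (1 : ℝ) < L := by exact_mod_cast hL
  have hJ' : (0 : ℝ) < J := by exact_mod_cast hJ
  have hπ := Real.pi_pos
  obtain ⟨r, hr, hrθ, hcosh⟩ := exists_rate (θ := Real.pi / L) (by positivity)
    (div_lt_self hπ hL')
  have hs : 0 < Real.sinh (r * J) := Real.sinh_pos_iff.2 (by positivity)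
  set G : ℤ → ℤ → ℝ := fun i j => η * Real.sin (Real.pi * i / L) *
    (Real.sinh (r * j) / Real.sinh (r * J)) with hG
  have hsin : ∀ i : ℤ, Real.sin (Real.pi * i / L) =
      Real.cos (Real.pi / L * i + -(Real.pi / 2)) := by
    intro i
    rw [← sub_eq_add_neg, Real.cos_sub_pi_div_two]
    congr 1
    ring
  have hsin0 : ∀ i : ℤ, 0 ≤ i → i ≤ L → 0 ≤ Real.sin (Real.pi * i / L) := by
    intro i hi hiL
    have hi' : (0 : ℝ) ≤ i := by exact_mod_cast hi
    have hiL' : (i : ℝ) ≤ L := by exact_mod_cast hiL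
    apply Real.sin_nonneg_of_nonneg_of_le_pi (by positivity)
    rw [div_le_iff₀ (by positivity)]
    gcongr
  have hharm : ∀ i j, G (i + 1) j + G (i - 1) j + G i (j + 1) + G i (j - 1) = 4 * G i j := by
    intro i j
    simp only [hG, hsin]
    linear_combination (η / Real.sinh (r * J)) *
      cos_mul_sinh_harmonic hcosh (-(Real.pi / 2)) i j
  have hle := hF.le hharm (fun i j h1 h2 h3 h4 hb => ?_) hi hiL hj hjJ
  · refine le_trans ?_ hle
    exact mul_le_mul_of_nonneg_left
      (div_div_cosh_le_sinh_div_sinh hr hrθ (by exact_mod_cast hj) hJ')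
      (mul_nonneg hη (hsin0 i hi hiL))
  · rcases hb with rfl | rfl | rfl | rfl
    · simpa [hG] using h0 0 j h1 h2 h3 h4
    · have : Real.pi * (i : ℝ) / i = Real.pi := by field_simp
      simpa [hG, this] using h0 i j h1 h2 h3 h4
    · simpa [hG] using h0 i 0 h1 h2 h3 h4
    · simpa [hG, div_self hs.ne'] using htop i h1 h2

lemma two_mul_sin_mul_sum_cos (x : ℝ) (K : ℕ) :
    2 * Real.sin x * ∑ k ∈ Finset.range K, Real.cos ((2 * k + 1) * x) =
      Real.sin (2 * K * x) := by
  induction K with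
  | zero => simp
  | succ K ih =>
    rw [Finset.sum_range_succ, mul_add, ih]
    have e1 : 2 * ((K + 1 : ℕ) : ℝ) * x = (2 * K + 1) * x + x := by push_cast; ring
    have e2 : 2 * (K : ℝ) * x = (2 * K + 1) * x - x := by ring
    rw [e1, e2, Real.sin_add, Real.sin_sub]
    ring

/-- A superharmonic function with a mass at the middle of one side of a rectangle. -/
lemma SuperharmonicOn.ge_of_spike {F : ℤ → ℤ → ℝ} {K : ℕ} {J : ℤ} (hK : 0 < K) (hJ : 0 < J)
    (hF : SuperharmonicOn F (-K) K 0 J)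
    (h0 : ∀ i j, -(K : ℤ) ≤ i → i ≤ K → 0 ≤ j → j ≤ J → 0 ≤ F i j) {D : ℝ} (hD : 0 ≤ D)
    (htop : D ≤ F 0 J) {j : ℤ} (hj : 0 ≤ j) (hjJ : j ≤ J) :
    D / K * (j / J / Real.cosh (Real.pi / (2 * K) * J)) ≤ F 0 j := by
  have hK' : (0 : ℝ) < K := by exact_mod_cast hK
  have hJ' : (0 : ℝ) < J := by exact_mod_cast hJ
  have hj' : (0 : ℝ) ≤ j := by exact_mod_cast hj
  have hπ := Real.pi_pos
  set θ : ℝ := Real.pi / (2 * K) with hθ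
  have hθ0 : 0 < θ := by positivity
  have hKθ : θ * K = Real.pi / 2 := by rw [hθ]; field_simp
  have hrate : ∀ k : ℕ, ∃ r : ℝ, k < K → 0 < r ∧ r ≤ (2 * k + 1) * θ ∧
      Real.cosh r = 2 - Real.cos ((2 * k + 1) * θ) := by
    intro k
    by_cases hk : k < K
    · have hk' : (k : ℝ) + 1 ≤ K := by exact_mod_cast hk
      obtain ⟨r, hr⟩ := exists_rate (θ := (2 * k + 1) * θ) (by positivity) (by nlinarith)
      exact ⟨r, fun _ => hr⟩
    · exact ⟨0, fun h => absurd h hk⟩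
  choose r hr using hrate
  have hs : ∀ k, k < K → 0 < Real.sinh (r k * J) := fun k hk =>
    Real.sinh_pos_iff.2 (mul_pos (hr k hk).1 hJ')
  set G : ℤ → ℤ → ℝ := fun i j => D / K * ∑ k ∈ Finset.range K,
    Real.cos ((2 * k + 1) * θ * i + 0) * Real.sinh (r k * j) / Real.sinh (r k * J) with hG
  have hharm : ∀ i j, G (i + 1) j + G (i - 1) j + G i (j + 1) + G i (j - 1) = 4 * G i j := by
    intro i j
    simp only [hG]
    rw [← mul_add, ← mul_add, ← mul_add, ← Finset.sum_add_distrib, ← Finset.sum_add_distrib,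
      ← Finset.sum_add_distrib, mul_left_comm, Finset.mul_sum _ _ (4 : ℝ)]
    congr 1
    refine Finset.sum_congr rfl fun k hk => ?_
    have := cos_mul_sinh_harmonic (hr k (Finset.mem_range.1 hk)).2.2 0 i j
    rw [← add_div, ← add_div, ← add_div, this, mul_div_assoc]
  have hside : ∀ k : ℕ, Real.cos ((2 * k + 1) * θ * K) = 0 := by
    intro k
    rw [mul_assoc, hKθ, Real.cos_eq_zero_iff]
    exact ⟨k, by push_cast; ring⟩
  have hle := hF.le hharm (fun i j h1 h2 h3 h4 hb => ?_) (i := 0) (j := j) (by simp) (by simp)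
    hj hjJ
  · refine le_trans ?_ hle
    refine mul_le_mul_of_nonneg_left ?_ (by positivity)
    have hterm : ∀ k ∈ Finset.range K, 0 ≤ Real.cos ((2 * k + 1) * θ * (0 : ℤ) + 0) *
        Real.sinh (r k * j) / Real.sinh (r k * J) := by
      intro k hk
      have hk := Finset.mem_range.1 hk
      have h1 := hs k hk
      have h2 : 0 ≤ Real.sinh (r k * j) :=
        Real.sinh_nonneg_iff.2 (mul_nonneg (hr k hk).1.le hj')
      simp only [Int.cast_zero, mul_zero, add_zero, Real.cos_zero, one_mul]
      positivity
    refine le_trans ?_ (Finset.single_le_sum hterm (Finset.mem_range.2 hK))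
    have h1 := hr 0 hK
    simp only [Nat.cast_zero, mul_zero, zero_add, one_mul] at h1
    simp only [Int.cast_zero, mul_zero, add_zero, Real.cos_zero, one_mul]
    exact div_div_cosh_le_sinh_div_sinh h1.1 h1.2.1 hj' hJ'
  · rcases hb with rfl | rfl | rfl | rfl
    · have : G (-(K : ℤ)) j = 0 := by
        simp only [hG]
        rw [Finset.sum_eq_zero, mul_zero]
        intro k _
        have : (2 * (k : ℝ) + 1) * θ * ((-(K : ℤ) : ℤ) : ℝ) + 0 = -((2 * k + 1) * θ * K) := by
          push_cast; ring
        rw [this, Real.cos_neg, hside, zero_mul, zero_div]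
      rw [this]
      exact h0 _ j h1 h2 h3 h4
    · have : G (K : ℤ) j = 0 := by
        simp only [hG]
        rw [Finset.sum_eq_zero, mul_zero]
        intro k _
        rw [Int.cast_natCast, add_zero, hside, zero_mul, zero_div]
      rw [this]
      exact h0 _ j h1 h2 h3 h4
    · simpa [hG] using h0 i 0 h1 h2 h3 h4
    · have hGtop : G i j = D / K * ∑ k ∈ Finset.range K, Real.cos ((2 * k + 1) * (θ * i)) := by
        simp only [hG]
        congr 1
        refine Finset.sum_congr rfl fun k hk => ?_
        rw [mul_div_assoc, div_self (hs k (Finset.mem_range.1 hk)).ne', mul_one, add_zero,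
          mul_assoc]
      by_cases hi : i = 0
      · subst hi
        rw [hGtop]
        simp only [Int.cast_zero, mul_zero, Real.cos_zero, Finset.sum_const, Finset.card_range,
          nsmul_eq_mul, mul_one]
        rw [div_mul_cancel₀ _ hK'.ne']
        exact htop
      · have htel := two_mul_sin_mul_sum_cos (θ * i) K
        have e : 2 * (K : ℝ) * (θ * i) = i * Real.pi := by
          linear_combination (2 * (i : ℝ)) * hKθ
        rw [e, Real.sin_int_mul_pi] at htel
        have hsin : Real.sin (θ * i) ≠ 0 := by
          have h1' : -(K : ℝ) ≤ i := by exact_mod_cast h1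
          have h2' : (i : ℝ) ≤ K := by exact_mod_cast h2
          rw [Ne, Real.sin_eq_zero_iff_of_lt_of_lt (by nlinarith) (by nlinarith)]
          exact mul_ne_zero hθ0.ne' (by exact_mod_cast hi)
        have hz : ∑ k ∈ Finset.range K, Real.cos ((2 * k + 1) * (θ * i)) = 0 := by
          rcases mul_eq_zero.1 htel with h | h
          · exact absurd h (mul_ne_zero two_ne_zero hsin)
          · exact h
        rw [hGtop, hz, mul_zero]
        exact h0 i j h1 h2 h3 h4

/-- Transport of mass from a point of the top side of a rectangle to a point of the bottom side,
for a nonnegative superharmonic function. -/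
lemma SuperharmonicOn.top_to_bottom {F : ℤ → ℤ → ℝ} {W n : ℤ} {K : ℕ} (hK : 0 < K) (hn : 0 < n)
    (hF : SuperharmonicOn F 0 W 0 (2 * n))
    (h0 : ∀ i j, 0 ≤ i → i ≤ W → 0 ≤ j → j ≤ 2 * n → 0 ≤ F i j)
    {x u : ℤ} (hx : 2 * (K : ℤ) ≤ x) (hxW : x + 2 * K ≤ W) (hu : (K : ℤ) ≤ u) (huW : u + K ≤ W)
    {D : ℝ} (hD : 0 ≤ D) (htop : D ≤ F u (2 * n)) :
    D / (Real.pi * W * n) / Real.cosh (Real.pi / (2 * K) * (2 * n)) /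
      Real.cosh (Real.pi / (2 * n) * W) / Real.cosh (Real.pi / (2 * K) * n) ≤ F x 1 := by
  have hK' : (0 : ℝ) < K := by exact_mod_cast hK
  have hn' : (0 : ℝ) < n := by exact_mod_cast hn
  have hW : 0 < W := by omega
  have hW' : (0 : ℝ) < W := by exact_mod_cast hW
  have hπ := Real.pi_pos
  set c₁ := Real.cosh (Real.pi / (2 * K) * (2 * n)) with hc₁
  set c₂ := Real.cosh (Real.pi / (2 * n) * W) with hc₂
  set c₃ := Real.cosh (Real.pi / (2 * K) * n) with hc₃
  have p₁ : 0 < c₁ := Real.cosh_pos _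
  have p₂ : 0 < c₂ := Real.cosh_pos _
  have p₃ : 0 < c₃ := Real.cosh_pos _
  have hA : ∀ j, 0 ≤ j → j ≤ 2 * n →
      D / K / Real.pi / c₁ * Real.sin (Real.pi * j / (2 * n : ℤ)) ≤ F u j := by
    intro j hj hj2
    have hS : SuperharmonicOn (fun i j => F (u + i) j) (-K) K 0 (2 * n) := by
      intro i j h1 h2 h3 h4
      have := hF (u + i) j (by omega) (by omega) h3 h4
      simp only
      rwa [← add_assoc, ← add_sub_assoc]
    have := hS.ge_of_spike hK (by omega)
      (fun i j h1 h2 h3 h4 => h0 (u + i) j (by omega) (by omega) h3 h4) hD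
      (by simpa using htop) hj hj2
    simp only [add_zero] at this
    refine le_trans ?_ this
    have hj' : (0 : ℝ) ≤ j := by exact_mod_cast hj
    push_cast
    rw [← hc₁]
    have hsin : Real.sin (Real.pi * j / (2 * n)) ≤ Real.pi * j / (2 * n) :=
      Real.sin_le (by positivity)
    calc D / K / Real.pi / c₁ * Real.sin (Real.pi * j / (2 * n))
        ≤ D / K / Real.pi / c₁ * (Real.pi * j / (2 * n)) := by gcongr
      _ = D / K * (j / (2 * n) / c₁) := by field_simp
  set η := D / K / Real.pi / c₁ with hη
  have hη0 : 0 ≤ η := by positivity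
  have hmid : Real.sin (Real.pi * n / (2 * n : ℤ)) = 1 := by
    rw [← Real.sin_pi_div_two]
    congr 1
    push_cast
    field_simp
  have hfrac : ∀ p q : ℤ, (K : ℤ) ≤ p → 0 < q → q ≤ W →
      η * (K / W / c₂) ≤ η * (p / q / Real.cosh (Real.pi / (2 * n : ℤ) * q)) := by
    intro p q hp hq hqW
    have hp' : (K : ℝ) ≤ p := by exact_mod_cast hp
    have hq' : (0 : ℝ) < q := by exact_mod_cast hq
    have hqW' : (q : ℝ) ≤ W := by exact_mod_cast hqW
    have hc : Real.cosh (Real.pi / (2 * n : ℤ) * q) ≤ c₂ := by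
      rw [hc₂, Real.cosh_le_cosh]
      push_cast
      rw [abs_of_pos (by positivity), abs_of_pos (by positivity)]
      gcongr
    have := Real.cosh_pos (Real.pi / (2 * n : ℤ) * q)
    have hp0 : (0 : ℝ) < p := hK'.trans_le hp'
    gcongr
  have hB : ∀ i, (K : ℤ) ≤ i → i + K ≤ W → η * (K / W / c₂) ≤ F i n := by
    intro i hi hiW
    rcases le_total i u with hiu | hiu
    · have hS : SuperharmonicOn (fun p q => F q p) 0 (2 * n) 0 u := by
        intro p q h1 h2 h3 h4
        have := hF q p h3 (by omega) h1 h2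
        simp only
        linarith
      have := hS.ge_of_arch (by omega) (by omega)
        (fun p q h1 h2 h3 h4 => h0 q p h3 (by omega) h1 h2) hη0 hA (i := n) (j := i)
        (by omega) (by omega) (by omega) hiu
      rw [hmid, mul_one] at this
      exact (hfrac i u hi (by omega) (by omega)).trans this
    · have hS : SuperharmonicOn (fun p q => F (W - q) p) 0 (2 * n) 0 (W - u) := by
        intro p q h1 h2 h3 h4
        have := hF (W - q) p (by omega) (by omega) h1 h2
        simp only
        rw [show W - (q + 1) = W - q - 1 by ring, show W - (q - 1) = W - q + 1 by ring]
        linarith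
      have := hS.ge_of_arch (by omega) (by omega)
        (fun p q h1 h2 h3 h4 => h0 (W - q) p (by omega) (by omega) h1 h2) hη0
        (fun p h1 h2 => by simpa using hA p h1 h2) (i := n) (j := W - i)
        (by omega) (by omega) (by omega) (by omega)
      rw [hmid, mul_one] at this
      simp only [sub_sub_cancel] at this
      exact (hfrac (W - i) (W - u) (by omega) (by omega) (by omega)).trans this
  set η' := η * (K / W / c₂) with hη'
  have hη'0 : 0 ≤ η' := by positivity
  have hS : SuperharmonicOn (fun i j => F (x - K + i) j) 0 (2 * K) 0 n := by
    intro i j h1 h2 h3 h4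
    have := hF (x - K + i) j (by omega) (by omega) h3 (by omega)
    simp only
    rwa [← add_assoc, ← add_sub_assoc]
  have := hS.ge_of_arch (by omega) hn
    (fun i j h1 h2 h3 h4 => h0 (x - K + i) j (by omega) (by omega) h3 (by omega)) hη'0
    (fun i h1 h2 => (mul_le_of_le_one_right hη'0 (Real.sin_le_one _)).trans
      (hB _ (by omega) (by omega))) (i := K) (j := 1)
    (by omega) (by omega) (by omega) (by omega)
  simp only [sub_add_cancel] at this
  refine le_trans (le_of_eq ?_) this
  have hmid' : Real.sin (Real.pi * (K : ℤ) / (2 * K : ℤ)) = 1 := by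
    rw [← Real.sin_pi_div_two]
    congr 1
    push_cast
    field_simp
  rw [hmid', hη', hη]
  push_cast
  rw [← hc₃]
  field_simp

/-! ## Correlations across a grid -/

/-- The gain in the correlation of two neighbouring spins coming from a common square. -/
noncomputable def squareGain : ℝ := (1 - (√2 - 1) ^ 2) * (√2 - 1) ^ 3 / 4

lemma squareGain_pos : 0 < squareGain := by
  have h0 := sqrt_two_sub_one_pos
  have h1 : √2 - 1 < 1 := by nlinarith [sq_sqrt_two]
  unfold squareGain
  have : 0 < 1 - (√2 - 1) ^ 2 := by nlinarith
  positivity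

lemma squareGain_le_one : squareGain ≤ 1 := by
  have h0 := sqrt_two_sub_one_pos
  have h1 : √2 - 1 < 1 := by nlinarith [sq_sqrt_two]
  have h2 : (√2 - 1) ^ 3 ≤ 1 := pow_le_one₀ h0.le h1.le
  have h3 : 0 ≤ (√2 - 1) ^ 3 := by positivity
  unfold squareGain
  nlinarith [sq_nonneg (√2 - 1)]

lemma sq_grid_correlation_ge {ι : Type*} {s : Finset ι} {g : ι → ℕ → ℕ → ℝ} {M n K : ℕ}
    (hs : FlipStable s g M (2 * n)) (hn : 0 < n) (hK : 0 < K) {c a : ℕ} (hc : c < M) (ha : a ≤ M)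
    (hKa : 2 * K ≤ a + 1) (haK : a + 2 * K ≤ M) (hKc : K ≤ c + 1) (hcK : c + K ≤ M)
    (hZ : 0 ≤ ∑ A ∈ s, gridWeight M (2 * n) (g A))
    (hlow : ((√2 - 1) + squareGain) * (∑ A ∈ s, gridWeight M (2 * n) (g A)) ≤
      ∑ A ∈ s, gridWeight M (2 * n) (g A) * (g A c (2 * n) * g A (c + 1) (2 * n)))
    (hup : ∑ A ∈ s, gridWeight M (2 * n) (g A) * (g A c (2 * n) * g A (c + 1) (2 * n)) ≤
      ∑ A ∈ s, gridWeight M (2 * n) (g A)) :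
    squareGain * (∑ A ∈ s, gridWeight M (2 * n) (g A)) ^ 2 / (Real.pi * (M + 1) * n) /
      Real.cosh (Real.pi / (2 * K) * (2 * n)) / Real.cosh (Real.pi / (2 * n) * (M + 1)) /
      Real.cosh (Real.pi / (2 * K) * n) ≤
    (∑ A ∈ s, gridWeight M (2 * n) (g A) * (g A c (2 * n) * g A a 0)) ^ 2 := by
  have hδ := squareGain_pos
  have hδ1 := squareGain_le_one
  set Z := ∑ A ∈ s, gridWeight M (2 * n) (g A) with hZdef
  set C := ∑ A ∈ s, gridWeight M (2 * n) (g A) * (g A c (2 * n) * g A (c + 1) (2 * n)) with hC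
  set F : ℤ → ℤ → ℝ := fun i j => primitive s g M (2 * n) c i.toNat j.toNat with hF
  have hsup : SuperharmonicOn F 0 (M + 1 : ℤ) 0 (2 * n + 1 : ℤ) := by
    intro i j h1 h2 h3 h4
    obtain ⟨i, rfl⟩ : ∃ k : ℕ, i = k + 1 := ⟨(i - 1).toNat, by omega⟩
    obtain ⟨j, rfl⟩ : ∃ k : ℕ, j = k + 1 := ⟨(j - 1).toNat, by omega⟩
    have := primitive_superharmonic hs c i j (by omega) (by omega)
    simp only [hF]
    rw [show ((i : ℤ) + 1 + 1).toNat = i + 2 by omega, show ((i : ℤ) + 1).toNat = i + 1 by omega,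
      show ((i : ℤ) + 1 - 1).toNat = i by omega, show ((j : ℤ) + 1 + 1).toNat = j + 2 by omega,
      show ((j : ℤ) + 1).toNat = j + 1 by omega, show ((j : ℤ) + 1 - 1).toNat = j by omega]
    linarith
  have h0 : ∀ i j, 0 ≤ i → i ≤ (M + 1 : ℤ) → 0 ≤ j → j ≤ (2 * n + 1 : ℤ) → 0 ≤ F i j := by
    intro i j h1 h2 h3 h4
    refine hsup.nonneg (fun i j h1 h2 h3 h4 hb => le_of_eq ?_) h1 h2 h3 h4
    simp only [hF]
    rcases hb with rfl | rfl | rfl | rfl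
    · exact (primitive_left _ _).symm
    · exact (primitive_right hs _ _ (by omega)).symm
    · exact (primitive_bottom _ _).symm
    · exact (primitive_top _ _).symm
  have htop : squareGain * Z ^ 2 ≤ F (c + 1 : ℤ) (2 * (n : ℤ)) := by
    have := primitive_source hs c hc
    simp only [hF]
    rw [show ((c : ℤ) + 1).toNat = c + 1 by omega, show (2 * (n : ℤ)).toNat = 2 * n by omega, this]
    have k1 : √2 * Z - C ≤ (1 - squareGain) * Z := by linarith
    have k2 : 0 ≤ √2 * Z - C := by
      have := mul_nonneg sqrt_two_sub_one_pos.le hZ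
      linarith
    have k3 := pow_le_pow_left₀ k2 k1 2
    have k4 : squareGain * Z ^ 2 ≤ Z ^ 2 - ((1 - squareGain) * Z) ^ 2 := by
      have : 0 ≤ squareGain * (1 - squareGain) * Z ^ 2 := by
        have : 0 ≤ 1 - squareGain := by linarith
        positivity
      linarith
    linarith
  have hmain := (hsup.mono le_rfl le_rfl le_rfl (by omega)).top_to_bottom (n := n) hK
    (by omega) (fun i j h1 h2 h3 h4 => h0 i j h1 h2 h3 (by omega)) (x := a + 1) (u := c + 1)
    (by omega) (by omega) (by omega) (by omega) (by positivity) htop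
  push_cast at hmain
  refine hmain.trans ?_
  exact primitive_bottom_row_le hs c a ha

/-! ## The rectangle as a grid -/

/-- The site of `ℤ²` with grid coordinates `(k, j)` in the rectangle of half-width `m`. -/
def site (m k j : ℕ) : V := ((k : ℤ) - m, (j : ℤ))

/-- The rectangle `⟦-m, m⟧ × ⟦0, N⟧`. -/
noncomputable def rect (m N : ℕ) : Finset V := Finset.Icc (-(m : ℤ)) m ×ˢ Finset.Icc 0 (N : ℤ)

/-- The horizontal edges of a rectangle. -/
noncomputable def horizontalEdges (m N : ℕ) : Finset (Sym2 V) :=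
  (Finset.range (N + 1) ×ˢ Finset.range (2 * m)).image
    fun p => s(site m p.2 p.1, site m (p.2 + 1) p.1)

/-- The vertical edges of a rectangle. -/
noncomputable def verticalEdges (m N : ℕ) : Finset (Sym2 V) :=
  (Finset.range N ×ˢ Finset.range (2 * m + 1)).image
    fun p => s(site m p.2 p.1, site m p.2 (p.1 + 1))

/-- The edges of a rectangle. -/
noncomputable def rectEdges (m N : ℕ) : Finset (Sym2 V) :=
  horizontalEdges m N ∪ verticalEdges m N

lemma mem_rect {m N : ℕ} {v : V} :
    v ∈ rect m N ↔ (-(m : ℤ) ≤ v.1 ∧ v.1 ≤ m) ∧ 0 ≤ v.2 ∧ v.2 ≤ N := by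
  simp [rect]

lemma site_mem_rect {m N k j : ℕ} (hk : k ≤ 2 * m) (hj : j ≤ N) : site m k j ∈ rect m N := by
  rw [mem_rect]
  simp only [site]
  omega

lemma exists_site {m N : ℕ} {v : V} (hv : v ∈ rect m N) :
    ∃ k j, k ≤ 2 * m ∧ j ≤ N ∧ v = site m k j := by
  rw [mem_rect] at hv
  refine ⟨(v.1 + m).toNat, v.2.toNat, by omega, by omega, ?_⟩
  ext <;> simp only [site] <;> omega

lemma site_inj {m k j k' j' : ℕ} : site m k j = site m k' j' ↔ k = k' ∧ j = j' := by
  simp [site]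

lemma adjacent_site {m k j k' j' : ℕ} (h : adjacent (site m k j) (site m k' j')) :
    (j = j' ∧ (k' = k + 1 ∨ k = k' + 1)) ∨ (k = k' ∧ (j' = j + 1 ∨ j = j' + 1)) := by
  unfold adjacent site at h
  simp only at h
  omega

lemma horizontal_mem {m N k j : ℕ} (hk : k < 2 * m) (hj : j ≤ N) :
    s(site m k j, site m (k + 1) j) ∈ rectEdges m N :=
  Finset.mem_union_left _ (Finset.mem_image.2
    ⟨(j, k), by simp only [Finset.mem_product, Finset.mem_range]; omega, rfl⟩)

lemma vertical_mem {m N k j : ℕ} (hk : k ≤ 2 * m) (hj : j < N) :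
    s(site m k j, site m k (j + 1)) ∈ rectEdges m N :=
  Finset.mem_union_right _ (Finset.mem_image.2
    ⟨(j, k), by simp only [Finset.mem_product, Finset.mem_range]; omega, rfl⟩)

lemma latticeEdges_rect (m N : ℕ) : latticeEdges ↑(rect m N) = ↑(rectEdges m N) := by
  ext e
  constructor
  · rintro ⟨⟨x, y, hxy, rfl⟩, he⟩
    obtain ⟨k, j, hk, hj, rfl⟩ := exists_site (he x (Sym2.mem_mk_left _ _))
    obtain ⟨k', j', hk', hj', rfl⟩ := exists_site (he y (Sym2.mem_mk_right _ _))
    rcases adjacent_site hxy with ⟨rfl, rfl | rfl⟩ | ⟨rfl, rfl | rfl⟩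
    · exact horizontal_mem (by omega) hj
    · rw [Sym2.eq_swap]
      exact horizontal_mem (by omega) hj
    · exact vertical_mem hk (by omega)
    · rw [Sym2.eq_swap]
      exact vertical_mem hk (by omega)
  · intro he
    rw [Finset.mem_coe, rectEdges, Finset.mem_union, horizontalEdges, verticalEdges] at he
    simp only [Finset.mem_image, Finset.mem_product, Finset.mem_range, Prod.exists] at he
    rcases he with ⟨j, k, ⟨hj, hk⟩, rfl⟩ | ⟨j, k, ⟨hj, hk⟩, rfl⟩
    · refine ⟨⟨_, _, by simp only [adjacent, site]; omega, rfl⟩, fun v hv => ?_⟩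
      rcases Sym2.mem_iff.1 hv with rfl | rfl <;> exact site_mem_rect (by omega) (by omega)
    · refine ⟨⟨_, _, by simp only [adjacent, site]; omega, rfl⟩, fun v hv => ?_⟩
      rcases Sym2.mem_iff.1 hv with rfl | rfl <;> exact site_mem_rect (by omega) (by omega)

lemma mem_rect_of_mem_rectEdges {m N : ℕ} : ∀ e ∈ rectEdges m N, ∀ v ∈ e, v ∈ rect m N := by
  intro e he v hv
  have : e ∈ latticeEdges ↑(rect m N) := by rw [latticeEdges_rect]; exact he
  exact this.2 v hv

lemma bw_rectEdges (m N : ℕ) (A : Finset V) :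
    bw (rectEdges m N) A = gridWeight (2 * m) N fun k j => spin (↑A) (site m k j) := by
  have hdisj : Disjoint (horizontalEdges m N) (verticalEdges m N) := by
    rw [Finset.disjoint_left]
    intro e he he'
    simp only [horizontalEdges, verticalEdges, Finset.mem_image, Prod.exists] at he he'
    obtain ⟨j, k, _, rfl⟩ := he
    obtain ⟨j', k', _, h⟩ := he'
    simp only [Sym2.eq_iff, site_inj] at h
    omega
  unfold bw gridWeight rectEdges
  rw [Finset.prod_union hdisj, horizontalEdges, verticalEdges, Finset.prod_image, Finset.prod_image,
    Finset.prod_product, Finset.prod_product]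
  · simp only [edgeSpinProd_mk]
  · rintro ⟨j, k⟩ _ ⟨j', k'⟩ _ h
    simp only [Sym2.eq_iff, site_inj] at h
    simp only [Prod.mk.injEq]
    omega
  · rintro ⟨j, k⟩ _ ⟨j', k'⟩ _ h
    simp only [Sym2.eq_iff, site_inj] at h
    simp only [Prod.mk.injEq]
    omega

lemma flipStable_rect (m N : ℕ) :
    FlipStable (rect m N).powerset (fun A k j => spin (↑A) (site m k j)) (2 * m) N where
  spin A k j := spin_eq_one_or _ _
  flip i j hi hj F := by
    set B : Finset V := (Finset.range (i + 1)).image fun k => site m k j with hB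
    have hBsub : B ⊆ rect m N := by
      intro v hv
      obtain ⟨k, hk, rfl⟩ := Finset.mem_image.1 hv
      rw [Finset.mem_range] at hk
      exact site_mem_rect (by omega) hj
    rw [← sum_powerset_symmDiff (rect m N) B hBsub
      (fun A => F fun k j => spin (↑A) (site m k j))]
    refine Finset.sum_congr rfl fun A _ => congrArg F ?_
    funext k l
    have hmem : site m k l ∈ B ↔ l = j ∧ k < i + 1 := by
      simp only [hB, Finset.mem_image, Finset.mem_range, site_inj]
      constructor
      · rintro ⟨k', h, rfl, rfl⟩
        exact ⟨rfl, h⟩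
      · rintro ⟨rfl, h⟩
        exact ⟨k, h, rfl, rfl⟩
    unfold flipRow
    rw [spin_symmDiff]
    by_cases h : l = j ∧ k < i + 1
    · rw [if_pos h, if_pos (hmem.2 h)]
    · rw [if_neg h, if_neg (fun h' => h (hmem.1 h'))]

lemma top_correlation_ge {m n c : ℕ} (hn : 0 < n) (hc : c < 2 * m) :
    ((√2 - 1) + squareGain) * ∑ A ∈ (rect m n).powerset, bw (rectEdges m n) A ≤
      ∑ A ∈ (rect m n).powerset, bw (rectEdges m n) A *
        (spin (↑A) (site m c n) * spin (↑A) (site m (c + 1) n)) := by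
  obtain ⟨n, rfl⟩ : ∃ k, n = k + 1 := ⟨n - 1, by omega⟩
  have h1 : s(site m c (n + 1), site m (c + 1) (n + 1)) ∈ rectEdges m (n + 1) :=
    horizontal_mem hc le_rfl
  have h2 : s(site m (c + 1) (n + 1), site m (c + 1) n) ∈ rectEdges m (n + 1) := by
    rw [Sym2.eq_swap]
    exact vertical_mem (by omega) (by omega)
  have h3 : s(site m (c + 1) n, site m c n) ∈ rectEdges m (n + 1) := by
    rw [Sym2.eq_swap]
    exact horizontal_mem hc (by omega)
  have h4 : s(site m c n, site m c (n + 1)) ∈ rectEdges m (n + 1) :=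
    vertical_mem (by omega) (by omega)
  set T : Finset V := {site m c (n + 1), site m (c + 1) (n + 1), site m (c + 1) n, site m c n}
    with hT
  have hout : ∀ p ∈ T, ∀ q ∈ T,
      s(p, q) ∉ (rectEdges m (n + 1)).filter fun e => ¬∀ v ∈ e, v ∈ T := by
    intro p hp q hq h
    refine (Finset.mem_filter.1 h).2 fun v hv => ?_
    rcases Sym2.mem_iff.1 hv with rfl | rfl <;> assumption
  refine neighbour_correlation (rect m (n + 1)) ((rectEdges m (n + 1)).filter fun e =>
    ¬∀ v ∈ e, v ∈ T) (fun e he => mem_rect_of_mem_rectEdges e (Finset.mem_filter.1 he).1)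
    ?_ ?_ ?_ ?_ (site_mem_rect (by omega) (by omega)) (site_mem_rect (by omega) (by omega))
    (z := site m (c + 1) n) (w := site m c n)
    (site_mem_rect (by omega) (by omega)) (site_mem_rect (by omega) (by omega)) ?_
  · exact hout _ (by simp [hT]) _ (by simp [hT])
  · simp only [Finset.mem_insert, not_or]
    exact ⟨by simp [site_inj], hout _ (by simp [hT]) _ (by simp [hT])⟩
  · simp only [Finset.mem_insert, not_or]
    exact ⟨by simp [site_inj], by simp [site_inj], hout _ (by simp [hT]) _ (by simp [hT])⟩
  · simp only [Finset.mem_insert, not_or]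
    exact ⟨by simp [site_inj], by simp [site_inj], by simp [site_inj],
      hout _ (by simp [hT]) _ (by simp [hT])⟩
  · ext e
    simp only [Finset.mem_insert, Finset.mem_filter]
    constructor
    · intro he
      by_cases h : ∀ v ∈ e, v ∈ T
      · have hlat : e ∈ latticeEdges ↑(rect m (n + 1)) := by rw [latticeEdges_rect]; exact he
        obtain ⟨⟨x, y, hxy, rfl⟩, _⟩ := hlat
        have hx := h x (Sym2.mem_mk_left _ _)
        have hy := h y (Sym2.mem_mk_right _ _)
        simp only [hT, Finset.mem_insert, Finset.mem_singleton] at hx hy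
        rcases hx with rfl | rfl | rfl | rfl <;> rcases hy with rfl | rfl | rfl | rfl <;>
          first
          | (exfalso; have := adjacent_site hxy; omega)
          | simp [Sym2.eq_swap]
      · exact Or.inr (Or.inr (Or.inr (Or.inr ⟨he, h⟩)))
    · rintro (rfl | rfl | rfl | rfl | h)
      · exact h4
      · exact h3
      · exact h2
      · exact h1
      · exact h.1

/-- Lower bound for the connection probability in terms of the shape of the rectangle. -/
lemma sq_FKIsing_rect_ge {m n K : ℕ} (hn : 0 < n) (hK : 0 < K) {x u : ℤ}
    (hx : |x| + 2 * K ≤ m) (hu : |u| + K ≤ m) :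
    squareGain / (Real.pi * (2 * m + 1) * n) /
      Real.cosh (Real.pi / (2 * K) * (2 * n)) / Real.cosh (Real.pi / (2 * n) * (2 * m + 1)) /
      Real.cosh (Real.pi / (2 * K) * n) ≤
    FKIsing ↑(rect m (2 * n)) ∅ {ω | Conn ω (x, 0) (u, 2 * (n : ℤ))} ^ 2 := by
  have hx' := abs_le.1 (show |x| ≤ m - 2 * K by linarith)
  have hu' := abs_le.1 (show |u| ≤ m - K by linarith)
  have exa : ((x, 0) : V) = site m (x + m).toNat 0 := by
    ext <;> simp only [site] <;> omega
  have exc : ((u, 2 * (n : ℤ)) : V) = site m (u + m).toNat (2 * n) := by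
    ext <;> simp only [site] <;> omega
  rw [exa, exc, FKIsing_conn_eq _ _ (latticeEdges_rect m (2 * n))
    (site_mem_rect (by omega) (by omega))]
  have hZ : 0 < ∑ A ∈ (rect m (2 * n)).powerset, bw (rectEdges m (2 * n)) A :=
    Finset.sum_pos (fun A _ => bw_pos _ A) ⟨∅, Finset.empty_mem_powerset _⟩
  have hlow := top_correlation_ge (m := m) (n := 2 * n) (c := (u + m).toNat) (by omega) (by omega)
  have hup : ∑ A ∈ (rect m (2 * n)).powerset, bw (rectEdges m (2 * n)) A *
      (spin (↑A) (site m (u + m).toNat (2 * n)) * spin (↑A) (site m ((u + m).toNat + 1) (2 * n))) ≤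
      ∑ A ∈ (rect m (2 * n)).powerset, bw (rectEdges m (2 * n)) A := by
    refine Finset.sum_le_sum fun A _ => mul_le_of_le_one_right (bw_pos _ A).le ?_
    rcases spin_eq_one_or ↑A (site m (u + m).toNat (2 * n)) with h | h <;>
      rcases spin_eq_one_or ↑A (site m ((u + m).toNat + 1) (2 * n)) with h' | h' <;>
      rw [h, h'] <;> norm_num
  have hmain := sq_grid_correlation_ge (flipStable_rect m (2 * n)) hn hK
    (c := (u + m).toNat) (a := (x + m).toNat) (by omega) (by omega) (by omega) (by omega)
    (by omega) (by omega)
  simp only [bw_rectEdges] at hlow hup hZ ⊢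
  have hmain := hmain hZ.le hlow hup
  rw [div_pow, le_div_iff₀ (by positivity)]
  refine le_trans (le_of_eq ?_) (hmain.trans (le_of_eq ?_))
  · push_cast
    ring
  · congr 1
    refine Finset.sum_congr rfl fun A _ => ?_
    ring

lemma FKIsing_rect_nonneg (m N : ℕ) {x u : V} (hx : x ∈ rect m N) (hu : u ∈ rect m N) :
    0 ≤ FKIsing ↑(rect m N) ∅ {ω | Conn ω x u} := by
  rw [FKIsing_conn_eq _ _ (latticeEdges_rect m N) hx]
  refine div_nonneg ?_ (Finset.sum_nonneg fun A _ => (bw_pos _ A).le)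
  simpa using griffiths (rect m N) (rectEdges m N) mem_rect_of_mem_rectEdges [x, u]
    (by simp [hx, hu])

lemma conn_rectEdges {m N k j : ℕ} (hk : k ≤ 2 * m) (hj : j ≤ N) :
    Conn ↑(rectEdges m N) (site m 0 0) (site m k j) := by
  have hrow : ∀ k ≤ 2 * m, Conn ↑(rectEdges m N) (site m 0 0) (site m k 0) := by
    intro k
    induction k with
    | zero => exact fun _ => Relation.ReflTransGen.refl
    | succ k ih =>
      exact fun hk => (ih (by omega)).tail
        ⟨by simp only [adjacent, site]; omega, horizontal_mem (by omega) (by omega)⟩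
  induction j with
  | zero => exact hrow k hk
  | succ j ih =>
    exact (ih (by omega)).tail
      ⟨by simp only [adjacent, site]; omega, vertical_mem hk (by omega)⟩

lemma Conn.symm {ω : Set (Sym2 V)} {x y : V} (h : Conn ω x y) : Conn ω y x := by
  have : Std.Symm fun u w => adjacent u w ∧ s(u, w) ∈ ω := by
    refine ⟨fun a b hab => ⟨?_, Sym2.eq_swap (a := a) (b := b) ▸ hab.2⟩⟩
    have := hab.1
    unfold adjacent at *
    omega
  exact Relation.ReflTransGen.stdSymm.symm _ _ h

lemma FKIsing_rect_pos (m N : ℕ) {x u : V} (hx : x ∈ rect m N) (hu : u ∈ rect m N) :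
    0 < FKIsing ↑(rect m N) ∅ {ω | Conn ω x u} := by
  have h1 : 0 < 1 - psd := by rw [one_sub_psd]; exact sqrt_two_sub_one_pos
  have h2 : 0 < psd := by unfold psd; positivity
  have hconn : Conn ↑(rectEdges m N) x u := by
    obtain ⟨k, j, hk, hj, rfl⟩ := exists_site hx
    obtain ⟨k', j', hk', hj', rfl⟩ := exists_site hu
    exact (conn_rectEdges hk hj).symm.trans (conn_rectEdges hk' hj')
  have key : ∀ ev : Set (Set (Sym2 V)), (↑(rectEdges m N) : Set (Sym2 V)) ∈ ev →
      0 < ∑' ω : Finset (Sym2 V),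
        if (↑ω : Set (Sym2 V)) ⊆ latticeEdges ↑(rect m N) ∧ (↑ω : Set (Sym2 V)) ∈ ev
        then FKweight psd 2 (latticeEdges ↑(rect m N)) ↑(rect m N) ∅ ω else 0 := by
    intro ev hev
    rw [tsum_config _ _ (latticeEdges_rect m N)]
    refine Finset.sum_pos' (fun ω _ => ?_)
      ⟨rectEdges m N, Finset.mem_powerset_self _, ?_⟩
    · split_ifs <;> positivity
    · rw [if_pos hev]
      positivity
  have hZ := key Set.univ (Set.mem_univ _)
  simp only [Set.mem_univ, and_true] at hZ
  exact div_pos (key {ω | Conn ω x u} hconn) hZ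

lemma Rnb_eq_rect {β : ℝ} (hβ : 0 < β) (n : ℕ) : Rnb β n = ↑(rect ⌊β * n⌋₊ (2 * n)) := by
  have h0 : 0 ≤ β * n := by positivity
  ext v
  rw [Finset.mem_coe, mem_rect]
  have h1 : -(β * n) ≤ (v.1 : ℝ) ↔ -(⌊β * n⌋₊ : ℤ) ≤ v.1 := by
    rw [Int.natCast_floor_eq_floor h0, @neg_le ℤ, Int.le_floor, Int.cast_neg, neg_le]
  have h2 : (v.1 : ℝ) ≤ β * n ↔ v.1 ≤ (⌊β * n⌋₊ : ℤ) := by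
    rw [Int.natCast_floor_eq_floor h0, Int.le_floor]
  unfold Rnb
  rw [Set.mem_ofPred_eq, h1, h2]
  push_cast
  tauto

lemma exists_pos_le_of_finset {α : Type*} (T : Finset α) (f : α → ℝ) :
    ∃ c : ℝ, 0 < c ∧ ∀ t ∈ T, 0 < f t → c ≤ f t := by
  induction T using Finset.induction_on with
  | empty => exact ⟨1, one_pos, by simp⟩
  | insert a T _ ih =>
    obtain ⟨c, hc, h⟩ := ih
    refine ⟨min c (if 0 < f a then f a else 1), lt_min hc (by split_ifs <;> linarith), ?_⟩
    intro t ht hft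
    rcases Finset.mem_insert.1 ht with rfl | ht
    · rw [if_pos hft]
      exact min_le_right _ _
    · exact (min_le_left _ _).trans (h t ht hft)

lemma mem_rect_floor {r : ℝ} (hr : 0 ≤ r) {N : ℕ} {x j : ℤ} (hx : |(x : ℝ)| ≤ r / 2) (hj : 0 ≤ j)
    (hjN : j ≤ N) : ((x, j) : V) ∈ rect ⌊r⌋₊ N := by
  have h := abs_le.1 hx
  rw [mem_rect, Int.natCast_floor_eq_floor hr]
  refine ⟨⟨?_, ?_⟩, hj, hjN⟩
  · rw [neg_le, Int.le_floor]
    push_cast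
    linarith
  · rw [Int.le_floor]
    linarith

/-- The bound for rectangles which are wide enough at the scale of the lattice. -/
lemma connection_lower_bound_of_wide {β : ℝ} (hβ : 0 < β) {n : ℕ} (hn : 1 ≤ n) (hwide : 8 ≤ β * n)
    {x u : ℤ} (hx : |(x : ℝ)| ≤ β * n / 2) (hu : |(u : ℝ)| ≤ β * n / 2) :
    √(squareGain / (3 * Real.pi * β) / Real.cosh (16 * Real.pi / β) /
      Real.cosh (3 * Real.pi * β / 2) / Real.cosh (8 * Real.pi / β)) / n ≤
    FKIsing (Rnb β n) ∅ {ω | Conn ω (x, 0) (u, 2 * (n : ℤ))} := by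
  have hn' : (0 : ℝ) < n := by exact_mod_cast hn
  have h0 : 0 ≤ β * n := by positivity
  have hπ := Real.pi_pos
  have hδ := squareGain_pos
  rw [Rnb_eq_rect hβ]
  set m := ⌊β * n⌋₊ with hm
  set K := ⌊β * n / 8⌋₊ with hK
  have hm1 : (m : ℝ) ≤ β * n := Nat.floor_le h0
  have hm2 : β * n < m + 1 := Nat.lt_floor_add_one _
  have hK1 : (K : ℝ) ≤ β * n / 8 := Nat.floor_le (by positivity)
  have hK2 : β * n / 8 < K + 1 := Nat.lt_floor_add_one _
  have hK3 : 1 ≤ K := Nat.le_floor (by push_cast; linarith)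
  have hK3' : (1 : ℝ) ≤ K := by exact_mod_cast hK3
  have hK4 : β * n / 16 ≤ K := by linarith
  have hxK : |x| + 2 * (K : ℤ) ≤ m := by
    have : ((|x| + 2 * K : ℤ) : ℝ) ≤ m := by push_cast; linarith
    exact_mod_cast this
  have huK : |u| + (K : ℤ) ≤ m := by
    have : ((|u| + K : ℤ) : ℝ) ≤ m := by push_cast; linarith
    exact_mod_cast this
  have hmain := sq_FKIsing_rect_ge (n := n) (by omega) (by omega) hxK huK
  have hnK : (n : ℝ) / K ≤ 16 / β := by
    rw [div_le_div_iff₀ (by positivity) hβ]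
    linarith
  have hc1 : Real.cosh (Real.pi / (2 * K) * (2 * n)) ≤ Real.cosh (16 * Real.pi / β) := by
    rw [Real.cosh_le_cosh, abs_of_pos (by positivity), abs_of_pos (by positivity)]
    calc Real.pi / (2 * K) * (2 * n) = Real.pi * (n / K) := by field_simp
      _ ≤ Real.pi * (16 / β) := by gcongr
      _ = 16 * Real.pi / β := by ring
  have hc2 : Real.cosh (Real.pi / (2 * n) * (2 * m + 1)) ≤ Real.cosh (3 * Real.pi * β / 2) := by
    rw [Real.cosh_le_cosh, abs_of_pos (by positivity), abs_of_pos (by positivity)]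
    calc Real.pi / (2 * n) * (2 * m + 1) ≤ Real.pi / (2 * n) * (3 * (β * n)) := by
          gcongr
          linarith
      _ = 3 * Real.pi * β / 2 := by field_simp
  have hc3 : Real.cosh (Real.pi / (2 * K) * n) ≤ Real.cosh (8 * Real.pi / β) := by
    rw [Real.cosh_le_cosh, abs_of_pos (by positivity), abs_of_pos (by positivity)]
    calc Real.pi / (2 * K) * n = Real.pi / 2 * (n / K) := by field_simp
      _ ≤ Real.pi / 2 * (16 / β) := by gcongr
      _ = 8 * Real.pi / β := by ring
  have p1 := Real.cosh_pos (Real.pi / (2 * K) * (2 * n))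
  have p2 := Real.cosh_pos (Real.pi / (2 * n) * (2 * m + 1))
  have p3 := Real.cosh_pos (Real.pi / (2 * K) * n)
  have hden : Real.pi * (2 * m + 1) * n ≤ 3 * Real.pi * β * n ^ 2 := by
    calc Real.pi * (2 * m + 1) * n ≤ Real.pi * (3 * (β * n)) * n := by
          gcongr
          linarith
      _ = 3 * Real.pi * β * n ^ 2 := by ring
  refine abs_le_of_sq_le_sq' ?_ (FKIsing_rect_nonneg m (2 * n)
    (mem_rect_floor h0 hx le_rfl (by omega)) (mem_rect_floor h0 hu (by omega) (by omega))) |>.2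
  refine le_trans ?_ hmain
  rw [div_pow, Real.sq_sqrt (by positivity)]
  calc squareGain / (3 * Real.pi * β) / Real.cosh (16 * Real.pi / β) /
      Real.cosh (3 * Real.pi * β / 2) / Real.cosh (8 * Real.pi / β) / (n : ℝ) ^ 2
      = squareGain / (3 * Real.pi * β * n ^ 2) / Real.cosh (16 * Real.pi / β) /
      Real.cosh (3 * Real.pi * β / 2) / Real.cosh (8 * Real.pi / β) := by ring
    _ ≤ _ := by gcongr

/-- **Proposition (connection probability for one point on the bottom side)**: for every
`β > 0` there is `c(β) > 0` such that for every `n ≥ 1`,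
`P⁰_{R_n^β}(x ↝ u) ≥ c(β)/n` for all `x = (x₁,0)` on the bottom side and `u = (u₁,2n)` on
the top side with `|x₁|, |u₁| ≤ βn/2`. -/
theorem one_point_connection_lower_bound (β : ℝ) (hβ : 0 < β) :
    ∃ c : ℝ, 0 < c ∧ ∀ n : ℕ, 1 ≤ n → ∀ x1 u1 : ℤ,
      |(x1 : ℝ)| ≤ β * n / 2 → |(u1 : ℝ)| ≤ β * n / 2 →
      c / (n : ℝ) ≤ FKIsing (Rnb β n) ∅ {ω | Conn ω (x1, 0) (u1, 2 * (n : ℤ))} := by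
  have hδ := squareGain_pos
  set c₁ := √(squareGain / (3 * Real.pi * β) / Real.cosh (16 * Real.pi / β) /
    Real.cosh (3 * Real.pi * β / 2) / Real.cosh (8 * Real.pi / β)) with hc₁
  have hc₁0 : 0 < c₁ := Real.sqrt_pos.2 (by positivity)
  obtain ⟨c₂, hc₂0, hc₂⟩ := exists_pos_le_of_finset
    (Finset.range (⌊8 / β⌋₊ + 1) ×ˢ Finset.Icc (-4 : ℤ) 4 ×ˢ Finset.Icc (-4 : ℤ) 4)
    fun t => FKIsing (Rnb β t.1) ∅ {ω | Conn ω (t.2.1, 0) (t.2.2, 2 * (t.1 : ℤ))}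
  refine ⟨min c₁ c₂, lt_min hc₁0 hc₂0, fun n hn x u hx hu => ?_⟩
  have hn' : (1 : ℝ) ≤ n := by exact_mod_cast hn
  rcases le_total 8 (β * n) with hwide | hthin
  · refine le_trans ?_ (connection_lower_bound_of_wide hβ hn hwide hx hu)
    gcongr
    exact min_le_left _ _
  · have hfour : ∀ y : ℤ, |(y : ℝ)| ≤ β * n / 2 → -4 ≤ y ∧ y ≤ 4 := by
      intro y hy
      have := abs_le.1 hy
      constructor
      · have : (-4 : ℝ) ≤ y := by linarith
        exact_mod_cast this
      · have : (y : ℝ) ≤ 4 := by linarith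
        exact_mod_cast this
    have h0 : 0 ≤ β * n := by positivity
    have hpos : 0 < FKIsing (Rnb β n) ∅ {ω | Conn ω (x, 0) (u, 2 * (n : ℤ))} := by
      rw [Rnb_eq_rect hβ]
      exact FKIsing_rect_pos _ _ (mem_rect_floor h0 hx le_rfl (by omega))
        (mem_rect_floor h0 hu (by omega) (by omega))
    have hmem : n < ⌊8 / β⌋₊ + 1 := by
      rw [Nat.lt_add_one_iff]
      apply Nat.le_floor
      rw [le_div_iff₀ hβ]
      linarith
    refine le_trans ?_ (hc₂ (n, x, u) ?_ hpos)
    · exact (div_le_self (lt_min hc₁0 hc₂0).le hn').trans (min_le_right _ _)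
    · simp only [Finset.mem_product, Finset.mem_range, Finset.mem_Icc]
      exact ⟨hmem, hfour x hx, hfour u hu⟩

end RSW
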